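/- arXiv:1402.5772 — 6 statements merged into one kernel-verified Lean document; each statement's English description precedes it below -/
import Mathlib

section
/- For all u₁, u₂ ∈ X_T one has (∫₀^T |F(u₁(t)) − F(u₂(t))|² dt)^{1/2} ≤ C · T^{(1−α)/2} · (‖u₁‖_{X_T}^p + ‖u₂‖_{X_T}^p) · ‖u₁ − u₂‖_{X_T}. -/
open MeasureTheory

/-- The squared `X_t`-norm: `‖u‖_{X_t}² = sup_{s∈[0,t]} ‖u(s)‖² + ∫₀ᵗ ‖u(s)‖_*² ds`,
where `‖·‖` is the `V`-norm (via the embedding `iEV`) and `‖·‖_*` is the `E`-norm. -/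
noncomputable def XnormSq {E V : Type*} [NormedAddCommGroup E] [InnerProductSpace ℝ E]
    [NormedAddCommGroup V] [InnerProductSpace ℝ V]
    (iEV : E →L[ℝ] V) (u : ℝ → E) (t : ℝ) : ℝ :=
  (⨆ s : Set.Icc (0 : ℝ) t, ‖iEV (u s.1)‖ ^ 2) + ∫ s in Set.Ioc (0 : ℝ) t, ‖u s‖ ^ 2

/-- Jensen's inequality for the concave power `x ↦ x ^ α`, with its integrability statement. -/
lemma integrableOn_rpow_and_setIntegral_rpow_le {f : ℝ → ℝ} {T α : ℝ} (hT : 0 < T)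
    (hα0 : 0 ≤ α) (hα1 : α ≤ 1) (hf0 : ∀ s, 0 ≤ f s)
    (hf : IntegrableOn f (Set.Ioc 0 T)) :
    IntegrableOn (fun s => f s ^ α) (Set.Ioc 0 T) ∧
      ∫ s in Set.Ioc 0 T, f s ^ α ≤ T ^ (1 - α) * (∫ s in Set.Ioc 0 T, f s) ^ α := by
  have hvol : volume (Set.Ioc 0 T) = ENNReal.ofReal T := by simp
  have hpow : IntegrableOn (fun s => f s ^ α) (Set.Ioc 0 T) := by
    have hone : IntegrableOn (fun _ => (1 : ℝ)) (Set.Ioc 0 T) :=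
      integrableOn_const (by simp [hvol])
    refine Integrable.mono' (hone.add hf)
      ((Real.continuous_rpow_const hα0).comp_aestronglyMeasurable hf.aestronglyMeasurable) ?_
    refine Filter.Eventually.of_forall fun s => ?_
    rw [Real.norm_of_nonneg (Real.rpow_nonneg (hf0 s) _)]
    rcases le_total (f s) 1 with h | h
    · have := Real.rpow_le_one (hf0 s) h hα0
      have := hf0 s
      simp only [Pi.add_apply]
      linarith
    · have := Real.rpow_le_rpow_of_exponent_le h hα1
      rw [Real.rpow_one] at this
      simp only [Pi.add_apply]
      linarith
  refine ⟨hpow, ?_⟩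
  have hI : 0 ≤ ∫ s in Set.Ioc 0 T, f s := integral_nonneg hf0
  have hJ := (Real.concaveOn_rpow hα0 hα1).le_map_set_average
    (Real.continuous_rpow_const hα0).continuousOn isClosed_Ici
    (by simp [hvol, hT]) (by simp [hvol])
    (Filter.Eventually.of_forall hf0) hf hpow
  simp only [setAverage_eq, Measure.real, hvol, ENNReal.toReal_ofReal hT.le, smul_eq_mul] at hJ
  rw [Real.mul_rpow (by positivity) hI, Real.inv_rpow hT.le] at hJ
  rw [Real.rpow_sub hT, Real.rpow_one]
  rw [inv_mul_le_iff₀ hT] at hJ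
  exact hJ.trans_eq (by ring)

/-- Minkowski's inequality in `L²` for nonnegative functions with given bounds. -/
lemma integral_sq_add_le {Ω : Type*} [MeasurableSpace Ω] {μ : Measure Ω} {f g : Ω → ℝ}
    {P Q : ℝ} (hf0 : ∀ x, 0 ≤ f x) (hg0 : ∀ x, 0 ≤ g x) (hf : MemLp f 2 μ) (hg : MemLp g 2 μ)
    (hP : 0 ≤ P) (hQ : 0 ≤ Q) (hfP : ∫ x, f x ^ 2 ∂μ ≤ P ^ 2) (hgQ : ∫ x, g x ^ 2 ∂μ ≤ Q ^ 2) :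
    ∫ x, (f x + g x) ^ 2 ∂μ ≤ (P + Q) ^ 2 := by
  have hmul : ∫ x, f x * g x ∂μ ≤ P * Q := by
    have h := integral_mul_le_Lp_mul_Lq_of_nonneg (μ := μ) (p := 2) (q := 2)
      Real.HolderConjugate.two_two (Filter.Eventually.of_forall hf0)
      (Filter.Eventually.of_forall hg0) (by simpa using hf) (by simpa using hg)
    simp only [Real.rpow_two, ← Real.sqrt_eq_rpow] at h
    refine h.trans (mul_le_mul ?_ ?_ (Real.sqrt_nonneg _) hP)
    · exact Real.sqrt_le_iff.2 ⟨hP, hfP⟩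
    · exact Real.sqrt_le_iff.2 ⟨hQ, hgQ⟩
  have hfg : Integrable (fun x => f x * g x) μ := hf.integrable_mul hg
  have hexp : ∀ x, (f x + g x) ^ 2 = f x ^ 2 + 2 * (f x * g x) + g x ^ 2 := fun x => by ring
  simp only [hexp]
  have hf2 : Integrable (fun x => f x ^ 2 + 2 * (f x * g x)) μ :=
    hf.integrable_sq.add (hfg.const_mul 2)
  rw [integral_add hf2 hg.integrable_sq, integral_add hf.integrable_sq (hfg.const_mul 2), integral_const_mul]
  linarith

section XnormSq

variable {E V : Type*} [NormedAddCommGroup E] [InnerProductSpace ℝ E]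
  [NormedAddCommGroup V] [InnerProductSpace ℝ V] {iEV : E →L[ℝ] V} {u : ℝ → E} {T : ℝ}

lemma setIntegral_sq_le_XnormSq :
    ∫ s in Set.Ioc (0 : ℝ) T, ‖u s‖ ^ 2 ≤ XnormSq iEV u T :=
  le_add_of_nonneg_left (Real.iSup_nonneg fun _ => by positivity)

lemma norm_le_sqrt_XnormSq
    (hu : BddAbove ((fun s => ‖iEV (u s)‖ ^ 2) '' Set.Icc (0 : ℝ) T))
    {s : ℝ} (hs : s ∈ Set.Icc (0 : ℝ) T) : ‖iEV (u s)‖ ≤ √(XnormSq iEV u T) := by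
  refine Real.le_sqrt_of_sq_le ?_
  rw [Set.image_eq_range] at hu
  exact (le_ciSup hu ⟨s, hs⟩).trans
    (le_add_of_nonneg_right (integral_nonneg fun _ => by positivity))

lemma memLp_norm_rpow_and_setIntegral_le {α : ℝ} (hT : 0 < T) (hα0 : 0 ≤ α) (hα1 : α ≤ 1)
    (hmeas : AEStronglyMeasurable u (volume.restrict (Set.Ioc (0 : ℝ) T)))
    (hint : IntegrableOn (fun s => ‖u s‖ ^ 2) (Set.Ioc (0 : ℝ) T)) :
    MemLp (fun s => ‖u s‖ ^ α) 2 (volume.restrict (Set.Ioc (0 : ℝ) T)) ∧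
      ∫ s in Set.Ioc (0 : ℝ) T, (‖u s‖ ^ α) ^ 2 ≤
        (T ^ ((1 - α) / 2) * √(XnormSq iEV u T) ^ α) ^ 2 := by
  have hcomm : ∀ x : ℝ, 0 ≤ x → (x ^ 2) ^ α = (x ^ α) ^ 2 := fun x hx => by
    rw [← Real.rpow_natCast_mul hx, mul_comm, Real.rpow_mul_natCast hx]
  obtain ⟨h₁, h₂⟩ := integrableOn_rpow_and_setIntegral_rpow_le hT hα0 hα1
    (fun s => sq_nonneg ‖u s‖) hint
  simp only [hcomm _ (norm_nonneg _)] at h₁ h₂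
  refine ⟨(memLp_two_iff_integrable_sq
    ((Real.continuous_rpow_const hα0).comp_aestronglyMeasurable hmeas.norm)).2 h₁, ?_⟩
  have hI : 0 ≤ ∫ s in Set.Ioc (0 : ℝ) T, ‖u s‖ ^ 2 := integral_nonneg fun _ => by positivity
  have hle := setIntegral_sq_le_XnormSq (iEV := iEV) (u := u) (T := T)
  rw [mul_pow, ← hcomm _ (Real.sqrt_nonneg _), Real.sq_sqrt (hI.trans hle), ← Real.rpow_natCast,
    ← Real.rpow_mul hT.le]
  refine h₂.trans ?_
  norm_num
  gcongr

end XnormSq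

/-- `(∫₀ᵀ |F(u₁(t)) − F(u₂(t))|² dt)^{1/2}
  ≤ C · T^{(1−α)/2} · (‖u₁‖_{X_T}^p + ‖u₂‖_{X_T}^p) · ‖u₁ − u₂‖_{X_T}`. -/
theorem L2_dist_F_le
    {E V H : Type*}
    [NormedAddCommGroup E] [InnerProductSpace ℝ E] [TopologicalSpace.SeparableSpace E]
    [NormedAddCommGroup V] [InnerProductSpace ℝ V] [TopologicalSpace.SeparableSpace V]
    [NormedAddCommGroup H] [InnerProductSpace ℝ H] [TopologicalSpace.SeparableSpace H]
    (iEV : E →L[ℝ] V) (iVH : V →L[ℝ] H)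
    (hEVinj : Function.Injective iEV) (hVHinj : Function.Injective iVH)
    (hEVdense : DenseRange iEV) (hVHdense : DenseRange iVH)
    (F : E → H) (C p α : ℝ) (hC : 0 < C) (hp : 1 ≤ p) (hα : α ∈ Set.Ico (0 : ℝ) 1)
    (hF0 : F 0 = 0)
    (hF : ∀ x y : E, ‖F y - F x‖ ≤
      C * (‖iEV (y - x)‖ * ‖iEV y‖ ^ (p - α) * ‖y‖ ^ α +
           ‖y - x‖ ^ α * ‖iEV (y - x)‖ ^ (1 - α) * ‖iEV x‖ ^ p))
    (T : ℝ) (hT : 0 < T)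
    (u₁ u₂ : ℝ → E)
    (humeas₁ : AEStronglyMeasurable u₁ (volume.restrict (Set.Ioc (0 : ℝ) T)))
    (hubdd₁ : BddAbove ((fun s => ‖iEV (u₁ s)‖ ^ 2) '' Set.Icc (0 : ℝ) T))
    (huint₁ : IntegrableOn (fun s => ‖u₁ s‖ ^ 2) (Set.Ioc (0 : ℝ) T))
    (humeas₂ : AEStronglyMeasurable u₂ (volume.restrict (Set.Ioc (0 : ℝ) T)))
    (hubdd₂ : BddAbove ((fun s => ‖iEV (u₂ s)‖ ^ 2) '' Set.Icc (0 : ℝ) T))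
    (huint₂ : IntegrableOn (fun s => ‖u₂ s‖ ^ 2) (Set.Ioc (0 : ℝ) T)) :
    Real.sqrt (∫ t in Set.Ioc (0 : ℝ) T, ‖F (u₁ t) - F (u₂ t)‖ ^ 2) ≤
      C * T ^ ((1 - α) / 2) *
        (Real.sqrt (XnormSq iEV u₁ T) ^ p + Real.sqrt (XnormSq iEV u₂ T) ^ p) *
        Real.sqrt (XnormSq iEV (fun t => u₁ t - u₂ t) T) := by
  obtain ⟨hα0, hα1⟩ := hα
  have hint : IntegrableOn (fun s => ‖u₁ s - u₂ s‖ ^ 2) (Set.Ioc (0 : ℝ) T) :=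
    (memLp_two_iff_integrable_sq_norm (humeas₁.sub humeas₂)).1
      (((memLp_two_iff_integrable_sq_norm humeas₁).2 huint₁).sub
        ((memLp_two_iff_integrable_sq_norm humeas₂).2 huint₂))
  have hbdd : BddAbove ((fun s => ‖iEV (u₁ s - u₂ s)‖ ^ 2) '' Set.Icc (0 : ℝ) T) := by
    obtain ⟨b₁, hb₁⟩ := hubdd₁
    obtain ⟨b₂, hb₂⟩ := hubdd₂
    refine ⟨2 * (b₁ + b₂), ?_⟩
    rintro _ ⟨s, hs, rfl⟩
    have h₁ := hb₁ ⟨s, hs, rfl⟩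
    have h₂ := hb₂ ⟨s, hs, rfl⟩
    have h₃ := norm_sub_le (iEV (u₁ s)) (iEV (u₂ s))
    simp only [map_sub] at h₁ h₂ ⊢
    nlinarith [sq_nonneg (‖iEV (u₁ s)‖ - ‖iEV (u₂ s)‖), norm_nonneg (iEV (u₁ s) - iEV (u₂ s))]
  obtain ⟨hm₁, hi₁⟩ := memLp_norm_rpow_and_setIntegral_le (iEV := iEV) hT hα0 hα1.le humeas₁ huint₁
  obtain ⟨hm, hi⟩ := memLp_norm_rpow_and_setIntegral_le (iEV := iEV) hT hα0 hα1.le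
    (humeas₁.sub humeas₂) hint
  have hn₁ := fun s hs => norm_le_sqrt_XnormSq (s := s) hubdd₁ hs
  have hn₂ := fun s hs => norm_le_sqrt_XnormSq (s := s) hubdd₂ hs
  have hn := fun s hs => norm_le_sqrt_XnormSq (u := fun s => u₁ s - u₂ s) (s := s) hbdd hs
  simp only [Pi.sub_apply] at hm hi hn
  change ∫ s in Set.Ioc (0 : ℝ) T, (‖u₁ s - u₂ s‖ ^ α) ^ 2 ≤
    (T ^ ((1 - α) / 2) * √(XnormSq iEV (fun t => u₁ t - u₂ t) T) ^ α) ^ 2 at hi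
  set A := √(XnormSq iEV u₁ T)
  set B := √(XnormSq iEV u₂ T)
  set D := √(XnormSq iEV (fun t => u₁ t - u₂ t) T)
  set τ := T ^ ((1 - α) / 2)
  have hA : 0 ≤ A := Real.sqrt_nonneg _
  have hB : 0 ≤ B := Real.sqrt_nonneg _
  have hD : 0 ≤ D := Real.sqrt_nonneg _
  have hτ : 0 ≤ τ := Real.rpow_nonneg hT.le _
  have hApow : A ^ (p - α) * A ^ α = A ^ p := by
    rw [← Real.rpow_add_of_nonneg hA (by linarith) hα0, sub_add_cancel]
  have hDpow : D ^ (1 - α) * D ^ α = D := by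
    rw [← Real.rpow_add_of_nonneg hD (by linarith) hα0, sub_add_cancel, Real.rpow_one]
  have hmink := integral_sq_add_le
    (f := fun s => (C * (D * A ^ (p - α))) * ‖u₁ s‖ ^ α)
    (g := fun s => (C * (D ^ (1 - α) * B ^ p)) * ‖u₁ s - u₂ s‖ ^ α)
    (P := (C * (D * A ^ (p - α))) * (τ * A ^ α))
    (Q := (C * (D ^ (1 - α) * B ^ p)) * (τ * D ^ α))
    (fun s => by positivity) (fun s => by positivity)
    (hm₁.const_mul _) (hm.const_mul _) (by positivity) (by positivity)
    (by
      simp only [mul_pow, integral_const_mul] at hi₁ ⊢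
      gcongr)
    (by
      simp only [mul_pow, integral_const_mul] at hi ⊢
      gcongr)
  have hrhs : (C * (D * A ^ (p - α))) * (τ * A ^ α) + (C * (D ^ (1 - α) * B ^ p)) * (τ * D ^ α) =
      C * τ * (A ^ p + B ^ p) * D := by
    calc _ = C * τ * (D * (A ^ (p - α) * A ^ α) + (D ^ (1 - α) * D ^ α) * B ^ p) := by ring
      _ = _ := by rw [hApow, hDpow]; ring
  rw [hrhs] at hmink
  refine Real.sqrt_le_iff.2 ⟨by positivity, le_trans ?_ hmink⟩
  refine integral_mono_of_nonneg (Filter.Eventually.of_forall fun s => by positivity)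
    ((hm₁.const_mul _).add (hm.const_mul _)).integrable_sq ?_
  refine (ae_restrict_iff' measurableSet_Ioc).2 (Filter.Eventually.of_forall fun s hs => ?_)
  have hs' := Set.Ioc_subset_Icc_self hs
  have h₁ := hn₁ s hs'
  have h₂ := hn₂ s hs'
  have h₃ := hn s hs'
  have hpα : 0 ≤ p - α := by linarith
  have h1α : 0 ≤ 1 - α := by linarith
  have hp0 : 0 ≤ p := by linarith
  refine pow_le_pow_left₀ (norm_nonneg _) ((hF (u₂ s) (u₁ s)).trans ?_) 2
  calc _ ≤ C * (D * A ^ (p - α) * ‖u₁ s‖ ^ α + ‖u₁ s - u₂ s‖ ^ α * D ^ (1 - α) * B ^ p) := by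
        gcongr
    _ = _ := by ring
end

section
/- For the GOY shell model, there exists a constant C > 0 (depending only on a, b and μ) such that for all complex sequences u = (u_n)_{n≥1}, w = (w_n)_{n≥1} with Σ_{n≥1}|u_n|² < ∞ and Σ_{n≥1}|w_n|² < ∞, and every complex sequence v = (v_n)_{n≥1} with Σ_{n≥1} k_n²|v_n|² < ∞, one has |Re Σ_{n≥1} [B(u,v)]_n · conj(w_n)| ≤ C · (Σ_{n≥1}|u_n|²)^{1/2} · (Σ_{n≥1} k_n²|v_n|²)^{1/2} · (Σ_{n≥1}|w_n|²)^{1/2}, where [B(u,v)]_n = −i·(a·k_{n+1}·conj(u_{n+1})·conj(v_{n+2}) + b·k_n·conj(u_{n−1})·conj(v_{n+1}) − a·k_{n−1}·conj(u_{n−1})·conj(v_{n−2}) − b·k_{n−1}·conj(u_{n−2})·conj(v_{n−1})). -/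
open scoped ComplexConjugate

/-- The `n`-th component of the GOY shell-model bilinear map `B(u,v)`, with wave numbers
`k_m = k₀ μ^m` and the convention `u_{-1} = u_0 = v_{-1} = v_0 = 0` (indices below `1`
truncate to `0`, where `u` and `v` vanish). -/
noncomputable def goyB (a b k₀ μ : ℝ) (u v : ℕ → ℂ) (m : ℕ) : ℂ :=
  -Complex.I *
    (((a * (k₀ * μ ^ (m + 1)) : ℝ) : ℂ) * conj (u (m + 1)) * conj (v (m + 2))
      + ((b * (k₀ * μ ^ m) : ℝ) : ℂ) * conj (u (m - 1)) * conj (v (m + 1))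
      - ((a * (k₀ * μ ^ (m - 1)) : ℝ) : ℂ) * conj (u (m - 1)) * conj (v (m - 2))
      - ((b * (k₀ * μ ^ (m - 1)) : ℝ) : ℂ) * conj (u (m - 2)) * conj (v (m - 1)))

/-- Cauchy–Schwarz inequality for square-summable nonnegative sequences. -/
theorem summable_mul_and_tsum_mul_le_sqrt {f g : ℕ → ℝ} (hf₀ : ∀ m, 0 ≤ f m) (hg₀ : ∀ m, 0 ≤ g m)
    (hf : Summable fun m => f m ^ 2) (hg : Summable fun m => g m ^ 2) :
    Summable (fun m => f m * g m) ∧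
      ∑' m, f m * g m ≤ √(∑' m, f m ^ 2) * √(∑' m, g m ^ 2) := by
  have hfp : Summable fun m => f m ^ (2 : ℝ) := by simpa using hf
  have hgp : Summable fun m => g m ^ (2 : ℝ) := by simpa using hg
  simpa [Real.sqrt_eq_rpow] using
    Real.summable_and_inner_le_Lp_mul_Lq_tsum_of_nonneg .two_two hf₀ hg₀ hfp hgp

/-- A sequence vanishing at `0` has the same square sum as its shift. -/
theorem hasSum_sq_of_zero {f : ℕ → ℝ} (h₀ : f 0 = 0) (hf : Summable fun m => f (m + 1) ^ 2) :
    HasSum (fun m => f m ^ 2) (∑' m, f (m + 1) ^ 2) := by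
  rw [← hasSum_nat_add_iff' 1]
  simpa [h₀] using hf.hasSum

theorem le_sqrt_tsum_sq {f : ℕ → ℝ} (hf : Summable fun m => f m ^ 2) (j : ℕ) :
    f j ≤ √(∑' m, f m ^ 2) :=
  Real.le_sqrt_of_sq_le (hf.le_tsum j fun _ _ => sq_nonneg _)

/-- Pointwise bound of the GOY bilinear map by products of neighbouring shells. -/
theorem norm_goyB_succ_le (a b : ℝ) {k₀ μ : ℝ} (hμ : 1 < μ) (hk₀ : 0 < k₀) (u v : ℕ → ℂ)
    (hv : v 0 = 0) (m : ℕ) :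
    ‖goyB a b k₀ μ u v (m + 1)‖ ≤ (|a| * μ + |b|) *
      (‖u (m + 2)‖ * (k₀ * μ ^ (m + 3) * ‖v (m + 3)‖) + ‖u m‖ * (k₀ * μ ^ (m + 2) * ‖v (m + 2)‖)
        + ‖u m‖ * (k₀ * μ ^ (m - 1) * ‖v (m - 1)‖) + ‖u (m - 1)‖ * (k₀ * μ ^ m * ‖v m‖)) := by
  have hμ₀ : 0 < μ := one_pos.trans hμ
  have ha := abs_nonneg a
  have hb := abs_nonneg b
  have haK : |a| ≤ |a| * μ + |b| := by nlinarith
  have hbK : |b| ≤ |a| * μ + |b| := le_add_of_nonneg_left (by positivity)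
  have haμK : |a| * μ ≤ |a| * μ + |b| := le_add_of_nonneg_right hb
  have h₁ : |a| * (k₀ * μ ^ (m + 2)) * ‖u (m + 2)‖ * ‖v (m + 3)‖ ≤
      (|a| * μ + |b|) * (‖u (m + 2)‖ * (k₀ * μ ^ (m + 3) * ‖v (m + 3)‖)) := by
    calc _ = |a| * (‖u (m + 2)‖ * (k₀ * μ ^ (m + 2) * ‖v (m + 3)‖)) := by ring
      _ ≤ _ := by gcongr <;> first | exact hμ.le | omega
  have h₂ : |b| * (k₀ * μ ^ (m + 1)) * ‖u m‖ * ‖v (m + 2)‖ ≤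
      (|a| * μ + |b|) * (‖u m‖ * (k₀ * μ ^ (m + 2) * ‖v (m + 2)‖)) := by
    calc _ = |b| * (‖u m‖ * (k₀ * μ ^ (m + 1) * ‖v (m + 2)‖)) := by ring
      _ ≤ _ := by gcongr <;> first | exact hμ.le | omega
  have h₃ : |a| * (k₀ * μ ^ m) * ‖u m‖ * ‖v (m - 1)‖ ≤
      (|a| * μ + |b|) * (‖u m‖ * (k₀ * μ ^ (m - 1) * ‖v (m - 1)‖)) := by
    cases m with
    | zero => simp [hv]
    | succ m =>
      rw [Nat.add_sub_cancel]
      calc _ = |a| * μ * (‖u (m + 1)‖ * (k₀ * μ ^ m * ‖v m‖)) := by ring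
        _ ≤ _ := by gcongr
  have h₄ : |b| * (k₀ * μ ^ m) * ‖u (m - 1)‖ * ‖v m‖ ≤
      (|a| * μ + |b|) * (‖u (m - 1)‖ * (k₀ * μ ^ m * ‖v m‖)) := by
    calc _ = |b| * (‖u (m - 1)‖ * (k₀ * μ ^ m * ‖v m‖)) := by ring
      _ ≤ _ := by gcongr
  have hk (j : ℕ) : |k₀ * μ ^ j| = k₀ * μ ^ j := abs_of_pos (by positivity)
  have hB : ‖goyB a b k₀ μ u v (m + 1)‖ ≤
      |a| * (k₀ * μ ^ (m + 2)) * ‖u (m + 2)‖ * ‖v (m + 3)‖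
        + |b| * (k₀ * μ ^ (m + 1)) * ‖u m‖ * ‖v (m + 2)‖
        + |a| * (k₀ * μ ^ m) * ‖u m‖ * ‖v (m - 1)‖
        + |b| * (k₀ * μ ^ m) * ‖u (m - 1)‖ * ‖v m‖ := by
    rw [goyB, norm_mul, norm_neg, Complex.norm_I, one_mul]
    refine (norm_sub_le _ _).trans (add_le_add ((norm_sub_le _ _).trans
      (add_le_add ((norm_add_le _ _).trans (add_le_add ?_ ?_)) ?_)) ?_) <;>
    · refine le_of_eq ?_
      rw [norm_mul, norm_mul, RCLike.norm_conj, RCLike.norm_conj, Complex.norm_real,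
        Real.norm_eq_abs, abs_mul, hk]
      try rfl
  linarith

/-- continuity of the GOY trilinear form:
`|Re Σ_{n≥1} [B(u,v)]_n conj(w_n)| ≤ C |u| · |A^{1/2} v| · |w|`,
with a constant `C` depending only on `a`, `b` and `μ`. -/
theorem goy_trilinear_estimate (a b μ : ℝ) (hμ : 1 < μ) :
    ∃ C : ℝ, 0 < C ∧
      ∀ (k₀ : ℝ), 0 < k₀ →
      ∀ u v w : ℕ → ℂ, u 0 = 0 → v 0 = 0 →
        Summable (fun m : ℕ => ‖u (m + 1)‖ ^ 2) →
        Summable (fun m : ℕ => (k₀ * μ ^ (m + 1)) ^ 2 * ‖v (m + 1)‖ ^ 2) →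
        Summable (fun m : ℕ => ‖w (m + 1)‖ ^ 2) →
        |(∑' m : ℕ, goyB a b k₀ μ u v (m + 1) * conj (w (m + 1))).re| ≤
          C * Real.sqrt (∑' m : ℕ, ‖u (m + 1)‖ ^ 2) *
            Real.sqrt (∑' m : ℕ, (k₀ * μ ^ (m + 1)) ^ 2 * ‖v (m + 1)‖ ^ 2) *
            Real.sqrt (∑' m : ℕ, ‖w (m + 1)‖ ^ 2) := by
  have hμ₀ : 0 < μ := one_pos.trans hμ
  have hK : 0 ≤ |a| * μ + |b| := by positivity
  refine ⟨4 * (|a| * μ + |b|) + 1, by positivity, fun k₀ hk₀ u v w hu hv hU hV hW => ?_⟩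
  set K := |a| * μ + |b|
  let U : ℕ → ℝ := fun m => ‖u m‖
  let V : ℕ → ℝ := fun m => k₀ * μ ^ m * ‖v m‖
  let W : ℕ → ℝ := fun m => ‖w (m + 1)‖
  simp only [← mul_pow] at hV ⊢
  have hU₀ (m : ℕ) : 0 ≤ U m := norm_nonneg _
  have hV₀ (m : ℕ) : 0 ≤ V m := by positivity
  have hW₀ (m : ℕ) : 0 ≤ W m := norm_nonneg _
  have hUs := hasSum_sq_of_zero (f := U) (by simp [U, hu]) hU
  have hVs := hasSum_sq_of_zero (f := V) (by simp [V, hv]) hV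
  change |_| ≤ (4 * K + 1) * √(∑' m, U (m + 1) ^ 2) * √(∑' m, V (m + 1) ^ 2) * √(∑' m, W m ^ 2)
  rw [← hUs.tsum_eq, ← hVs.tsum_eq]
  obtain ⟨hs₀, hle₀⟩ := summable_mul_and_tsum_mul_le_sqrt hU₀ hW₀ hUs.summable hW
  obtain ⟨hs₂, hle₂⟩ := summable_mul_and_tsum_mul_le_sqrt (f := fun m => U (m + 2))
    (fun m => hU₀ _) hW₀ ((summable_nat_add_iff 2).2 hUs.summable) hW
  obtain ⟨hsV, hleV⟩ := summable_mul_and_tsum_mul_le_sqrt hV₀ hW₀ hVs.summable hW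
  have hshift : ∑' m, U (m + 2) ^ 2 ≤ ∑' m, U m ^ 2 := by
    rw [← hUs.summable.sum_add_tsum_nat_add 2]
    exact le_add_of_nonneg_left (Finset.sum_nonneg fun _ _ => sq_nonneg _)
  replace hle₂ := hle₂.trans
    (mul_le_mul_of_nonneg_right (Real.sqrt_le_sqrt hshift) (Real.sqrt_nonneg _))
  have hUle := le_sqrt_tsum_sq hUs.summable
  have hVle := le_sqrt_tsum_sq hVs.summable
  set SU := √(∑' m, U m ^ 2)
  set SV := √(∑' m, V m ^ 2)
  set SW := √(∑' m, W m ^ 2)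
  have hSU : 0 ≤ SU := Real.sqrt_nonneg _
  have hSV : 0 ≤ SV := Real.sqrt_nonneg _
  have hSW : 0 ≤ SW := Real.sqrt_nonneg _
  have hbound (m : ℕ) : ‖goyB a b k₀ μ u v (m + 1) * conj (w (m + 1))‖ ≤
      K * (SV * (U (m + 2) * W m) + 2 * SV * (U m * W m) + SU * (V m * W m)) := by
    rw [norm_mul, RCLike.norm_conj]
    calc _ ≤ K * (U (m + 2) * V (m + 3) + U m * V (m + 2) + U m * V (m - 1) + U (m - 1) * V m)
          * W m := mul_le_mul_of_nonneg_right (norm_goyB_succ_le a b hμ hk₀ u v hv m) (hW₀ m)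
      _ ≤ K * (U (m + 2) * SV + U m * SV + U m * SV + SU * V m) * W m := by
        gcongr <;> first | exact hW₀ _ | exact hU₀ _ | exact hV₀ _ | exact hVle _ | exact hUle _
      _ = _ := by ring
  have hsum := ((((hs₂.hasSum.mul_left SV).add (hs₀.hasSum.mul_left (2 * SV))).add
    (hsV.hasSum.mul_left SU)).mul_left K)
  calc _ ≤ ‖∑' m, goyB a b k₀ μ u v (m + 1) * conj (w (m + 1))‖ := Complex.abs_re_le_norm _
    _ ≤ _ := tsum_of_norm_bounded hsum hbound
    _ ≤ K * (SV * (SU * SW) + 2 * SV * (SU * SW) + SU * (SV * SW)) := by gcongr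
    _ = 4 * K * SU * SV * SW := by ring
    _ ≤ (4 * K + 1) * SU * SV * SW := by gcongr; linarith
end

section
/- For the Sabra shell model, there exists a constant C > 0 (depending only on a, b and μ) such that for all complex sequences u = (u_n)_{n≥1}, w = (w_n)_{n≥1} with Σ_{n≥1}|u_n|² < ∞ and Σ_{n≥1}|w_n|² < ∞, and every complex sequence v = (v_n)_{n≥1} with Σ_{n≥1} k_n²|v_n|² < ∞, one has |Re Σ_{n≥1} [B(u,v)]_n · conj(w_n)| ≤ C · (Σ_{n≥1}|u_n|²)^{1/2} · (Σ_{n≥1} k_n²|v_n|²)^{1/2} · (Σ_{n≥1}|w_n|²)^{1/2}, where [B(u,v)]_n = −i·(a·k_{n+1}·conj(u_{n+1})·v_{n+2} + b·k_n·conj(u_{n−1})·v_{n+1} + a·k_{n−1}·u_{n−1}·v_{n−2} + b·k_{n−1}·u_{n−2}·v_{n−1}). -/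
open scoped ComplexConjugate

/-- The `n`-th component of the Sabra shell-model bilinear map `B(u,v)`, with wave numbers
`k_m = k₀ μ^m` and the convention `u_{-1} = u_0 = v_{-1} = v_0 = 0` (indices below `1`
truncate to `0`, where `u` and `v` vanish). -/
noncomputable def sabraB (a b k₀ μ : ℝ) (u v : ℕ → ℂ) (m : ℕ) : ℂ :=
  -Complex.I *
    (((a * (k₀ * μ ^ (m + 1)) : ℝ) : ℂ) * conj (u (m + 1)) * v (m + 2)
      + ((b * (k₀ * μ ^ m) : ℝ) : ℂ) * conj (u (m - 1)) * v (m + 1)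
      + ((a * (k₀ * μ ^ (m - 1)) : ℝ) : ℂ) * u (m - 1) * v (m - 2)
      + ((b * (k₀ * μ ^ (m - 1)) : ℝ) : ℂ) * u (m - 2) * v (m - 1))

/-- Cauchy-Schwarz for real sequences, in the form of a bound by `√A * √B`. -/
theorem summable_mul_and_tsum_mul_le {f g : ℕ → ℝ} {A B : ℝ}
    (hf0 : ∀ n, 0 ≤ f n) (hg0 : ∀ n, 0 ≤ g n)
    (hf : Summable fun n => f n ^ 2) (hg : Summable fun n => g n ^ 2)
    (hA : ∑' n, f n ^ 2 ≤ A) (hB : ∑' n, g n ^ 2 ≤ B) :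
    (Summable fun n => f n * g n) ∧ ∑' n, f n * g n ≤ √A * √B := by
  have h := Real.summable_and_inner_le_Lp_mul_Lq_tsum_of_nonneg
    (p := 2) (q := 2) Real.HolderConjugate.two_two hf0 hg0
    (by simpa using hf) (by simpa using hg)
  refine ⟨h.1, h.2.trans ?_⟩
  simp only [Real.rpow_two, ← Real.sqrt_eq_rpow]
  gcongr

theorem tsum_nat_add_le {f : ℕ → ℝ} (hf0 : ∀ n, 0 ≤ f n) (hf : Summable f) (k : ℕ) :
    ∑' n, f (n + k) ≤ ∑' n, f n := by
  have h := hf.sum_add_tsum_nat_add k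
  have := Finset.sum_nonneg fun i (_ : i ∈ Finset.range k) => hf0 i
  linarith

/-- Termwise bound for the Sabra nonlinearity when `‖u‖` is bounded by `U`. -/
theorem norm_sabraB_succ_le {a b k₀ μ U : ℝ} (hμ : 1 ≤ μ) (hk : 0 ≤ k₀) {u v : ℕ → ℂ}
    (hv : v 0 = 0) (hU : ∀ n, ‖u n‖ ≤ U) (m : ℕ) :
    ‖sabraB a b k₀ μ u v (m + 1)‖ ≤
      U * (|a| * (k₀ * μ ^ (m + 3) * ‖v (m + 3)‖) + |b| * (k₀ * μ ^ (m + 2) * ‖v (m + 2)‖)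
        + |a| * μ * (k₀ * μ ^ (m - 1) * ‖v (m - 1)‖) + |b| * (k₀ * μ ^ m * ‖v m‖)) := by
  have hU0 : 0 ≤ U := (norm_nonneg _).trans (hU 0)
  have hμ0 : 0 ≤ μ := by linarith
  have h1 : ‖((a * (k₀ * μ ^ (m + 2)) : ℝ) : ℂ) * conj (u (m + 2)) * v (m + 3)‖
      ≤ U * (|a| * (k₀ * μ ^ (m + 3) * ‖v (m + 3)‖)) := by
    rw [norm_mul, norm_mul, RCLike.norm_conj, Complex.norm_real, Real.norm_eq_abs, abs_mul,
      abs_of_nonneg (by positivity : 0 ≤ k₀ * μ ^ (m + 2))]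
    calc |a| * (k₀ * μ ^ (m + 2)) * ‖u (m + 2)‖ * ‖v (m + 3)‖
        ≤ |a| * (k₀ * μ ^ (m + 3)) * U * ‖v (m + 3)‖ := by
          gcongr
          · norm_num
          · exact hU _
      _ = _ := by ring
  have h2 : ‖((b * (k₀ * μ ^ (m + 1)) : ℝ) : ℂ) * conj (u m) * v (m + 2)‖
      ≤ U * (|b| * (k₀ * μ ^ (m + 2) * ‖v (m + 2)‖)) := by
    rw [norm_mul, norm_mul, RCLike.norm_conj, Complex.norm_real, Real.norm_eq_abs, abs_mul,
      abs_of_nonneg (by positivity : 0 ≤ k₀ * μ ^ (m + 1))]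
    calc |b| * (k₀ * μ ^ (m + 1)) * ‖u m‖ * ‖v (m + 2)‖
        ≤ |b| * (k₀ * μ ^ (m + 2)) * U * ‖v (m + 2)‖ := by
          gcongr
          · norm_num
          · exact hU _
      _ = _ := by ring
  have h3 : ‖((a * (k₀ * μ ^ m) : ℝ) : ℂ) * u m * v (m - 1)‖
      ≤ U * (|a| * μ * (k₀ * μ ^ (m - 1) * ‖v (m - 1)‖)) := by
    rcases m with _ | m
    · simp [hv]
    rw [norm_mul, norm_mul, Complex.norm_real, Real.norm_eq_abs, abs_mul,
      abs_of_nonneg (by positivity : 0 ≤ k₀ * μ ^ (m + 1)), Nat.add_sub_cancel]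
    calc |a| * (k₀ * μ ^ (m + 1)) * ‖u (m + 1)‖ * ‖v m‖
        ≤ |a| * (k₀ * μ ^ (m + 1)) * U * ‖v m‖ := by
          gcongr
          exact hU _
      _ = _ := by ring
  have h4 : ‖((b * (k₀ * μ ^ m) : ℝ) : ℂ) * u (m - 1) * v m‖
      ≤ U * (|b| * (k₀ * μ ^ m * ‖v m‖)) := by
    rw [norm_mul, norm_mul, Complex.norm_real, Real.norm_eq_abs, abs_mul,
      abs_of_nonneg (by positivity : 0 ≤ k₀ * μ ^ m)]
    calc |b| * (k₀ * μ ^ m) * ‖u (m - 1)‖ * ‖v m‖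
        ≤ |b| * (k₀ * μ ^ m) * U * ‖v m‖ := by
          gcongr
          exact hU _
      _ = _ := by ring
  have e : m + 1 - 2 = m - 1 := by omega
  rw [sabraB, norm_mul, norm_neg, Complex.norm_I, one_mul, Nat.add_sub_cancel, e]
  refine norm_add₄_le.trans ?_
  linarith

/-- continuity of the Sabra trilinear form:
`|Re Σ_{n≥1} [B(u,v)]_n conj(w_n)| ≤ C |u| · |A^{1/2} v| · |w|`,
with a constant `C` depending only on `a`, `b` and `μ`. -/
theorem sabra_trilinear_estimate (a b μ : ℝ) (hμ : 1 < μ) :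
    ∃ C : ℝ, 0 < C ∧
      ∀ (k₀ : ℝ), 0 < k₀ →
      ∀ u v w : ℕ → ℂ, u 0 = 0 → v 0 = 0 →
        Summable (fun m : ℕ => ‖u (m + 1)‖ ^ 2) →
        Summable (fun m : ℕ => (k₀ * μ ^ (m + 1)) ^ 2 * ‖v (m + 1)‖ ^ 2) →
        Summable (fun m : ℕ => ‖w (m + 1)‖ ^ 2) →
        |(∑' m : ℕ, sabraB a b k₀ μ u v (m + 1) * conj (w (m + 1))).re| ≤
          C * Real.sqrt (∑' m : ℕ, ‖u (m + 1)‖ ^ 2) *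
            Real.sqrt (∑' m : ℕ, (k₀ * μ ^ (m + 1)) ^ 2 * ‖v (m + 1)‖ ^ 2) *
            Real.sqrt (∑' m : ℕ, ‖w (m + 1)‖ ^ 2) := by
  refine ⟨|a| + |b| + |a| * μ + |b| + 1, by positivity, ?_⟩
  intro k₀ hk u v w hu0 hv0 hu hv hw
  set S := ∑' m : ℕ, ‖u (m + 1)‖ ^ 2
  set T := ∑' m : ℕ, (k₀ * μ ^ (m + 1)) ^ 2 * ‖v (m + 1)‖ ^ 2 with hT
  set W := ∑' m : ℕ, ‖w (m + 1)‖ ^ 2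
  have hU : ∀ n, ‖u n‖ ≤ √S := by
    rintro (_ | n)
    · simp [hu0]
    · exact Real.le_sqrt_of_sq_le (hu.le_tsum n fun _ _ => by positivity)
  set ν : ℕ → ℝ := fun n => k₀ * μ ^ n * ‖v n‖ with hν
  have hν0 : ∀ n, 0 ≤ ν n := fun n => by positivity
  have hνz : ν 0 = 0 := by simp [hν, hv0]
  have hνs : Summable fun n => ν n ^ 2 := by
    rw [← summable_nat_add_iff 1]
    simpa only [hν, mul_pow _ ‖_‖] using hv
  have hνT : ∑' n, ν n ^ 2 = T := by
    rw [hνs.tsum_eq_zero_add, hνz, hT]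
    simp only [hν, mul_pow _ ‖_‖]
    simp
  have shift (k : ℕ) := summable_mul_and_tsum_mul_le (B := W) (fun n => hν0 (n + k))
    (fun n => norm_nonneg (w (n + 1))) ((summable_nat_add_iff k).2 hνs) hw
    ((tsum_nat_add_le (fun n => sq_nonneg (ν n)) hνs k).trans hνT.le) le_rfl
  have hps : Summable fun n => ν (n - 1) ^ 2 := by
    rw [← summable_nat_add_iff 1]
    simpa using hνs
  have hpT : ∑' n, ν (n - 1) ^ 2 ≤ T := by
    rw [hps.tsum_eq_zero_add]
    simp [hνz, hνT]
  obtain ⟨s3, t3⟩ := shift 3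
  obtain ⟨s2, t2⟩ := shift 2
  obtain ⟨s0, t0⟩ := shift 0
  obtain ⟨sp, tp⟩ := summable_mul_and_tsum_mul_le (B := W) (fun n => hν0 (n - 1))
    (fun n => norm_nonneg (w (n + 1))) hps hw hpT le_rfl
  have hsum := ((((s3.hasSum.mul_left |a|).add (s2.hasSum.mul_left |b|)).add
    (sp.hasSum.mul_left (|a| * μ))).add (s0.hasSum.mul_left |b|)).mul_left √S
  have hbound := tsum_of_norm_bounded (f := fun m => sabraB a b k₀ μ u v (m + 1) * conj (w (m + 1)))
    hsum fun m => by
      rw [norm_mul, RCLike.norm_conj]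
      calc _ ≤ _ := mul_le_mul_of_nonneg_right
            (norm_sabraB_succ_le hμ.le hk.le hv0 hU m) (norm_nonneg _)
        _ = _ := by simp only [hν, add_zero]; ring
  calc _ ≤ _ := Complex.abs_re_le_norm _
    _ ≤ _ := hbound
    _ ≤ √S * (|a| * (√T * √W) + |b| * (√T * √W) + |a| * μ * (√T * √W) + |b| * (√T * √W)) := by
        gcongr
    _ ≤ √S * (|a| * (√T * √W) + |b| * (√T * √W) + |a| * μ * (√T * √W) + |b| * (√T * √W))
        + √S * (√T * √W) := le_add_of_nonneg_right (by positivity)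
    _ = _ := by ring
end

section
/- For the dyadic shell model with λ > 1 and α ≥ 1/2, there exists a constant C > 0 (depending only on λ) such that for all real sequences u = (u_n)_{n≥1}, v = (v_n)_{n≥1}, w = (w_n)_{n≥1} with Σ_{n≥1} λ^{2αn} u_n² < ∞, Σ_{n≥1} λ^{2αn} v_n² < ∞ and Σ_{n≥1} w_n² < ∞, one has |Σ_{n≥1} (−λⁿ·u_{n−1}·v_{n−1} + λ^{n+1}·u_n·v_{n+1})·w_n| ≤ C · (Σ_{n≥1} λ^{2αn} u_n²)^{1/2} · (Σ_{n≥1} λ^{2αn} v_n²)^{1/2} · (Σ_{n≥1} w_n²)^{1/2}. -/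
/-- Cauchy–Schwarz for square-summable real sequences. -/
theorem summable_abs_mul_and_tsum_le_sqrt_mul_sqrt {ι : Type*} {a b : ι → ℝ}
    (ha : Summable fun i => a i ^ 2) (hb : Summable fun i => b i ^ 2) :
    (Summable fun i => |a i * b i|) ∧
      ∑' i, |a i * b i| ≤ √(∑' i, a i ^ 2) * √(∑' i, b i ^ 2) := by
  have h := Real.summable_and_inner_le_Lp_mul_Lq_tsum_of_nonneg
    (f := fun i => |a i|) (g := fun i => |b i|)
    Real.HolderConjugate.two_two (fun i => abs_nonneg _) (fun i => abs_nonneg _)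
    (by simpa using ha) (by simpa using hb)
  simpa [abs_mul, Real.sqrt_eq_rpow] using h

/-- The trilinear form `∑ f g w` is bounded on `ℓ² × ℓ² × ℓ²`. -/
theorem summable_abs_mul_mul_and_tsum_le {ι : Type*} {f g w : ι → ℝ}
    (hf : Summable fun i => f i ^ 2) (hg : Summable fun i => g i ^ 2)
    (hw : Summable fun i => w i ^ 2) :
    (Summable fun i => |f i * g i * w i|) ∧
      ∑' i, |f i * g i * w i| ≤
        √(∑' i, f i ^ 2) * √(∑' i, g i ^ 2) * √(∑' i, w i ^ 2) := by
  obtain ⟨hs, hle⟩ := summable_abs_mul_and_tsum_le_sqrt_mul_sqrt hg hw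
  have hbound : ∀ i, |f i * g i * w i| ≤ √(∑' i, f i ^ 2) * |g i * w i| := fun i => by
    rw [mul_assoc, abs_mul]
    gcongr
    exact Real.abs_le_sqrt (hf.le_tsum i fun j _ => sq_nonneg _)
  have hsum := Summable.of_nonneg_of_le (fun i => abs_nonneg _) hbound (hs.mul_left _)
  refine ⟨hsum, (hsum.tsum_le_tsum hbound (hs.mul_left _)).trans ?_⟩
  rw [tsum_mul_left, mul_assoc]
  gcongr

/-- Shifted sums of the squares of the weighted sequence `λ^{αn} uₙ` are controlled by the
weighted norm. -/
theorem summable_weighted_shift_and_tsum_le {lam α : ℝ} (hlam : 0 < lam) {u : ℕ → ℝ}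
    (hu0 : u 0 = 0)
    (hu : Summable fun m : ℕ => lam ^ (2 * α * ((m : ℝ) + 1)) * u (m + 1) ^ 2) (k : ℕ) :
    (Summable fun m : ℕ => (lam ^ (α * ((m + k : ℕ) : ℝ)) * u (m + k)) ^ 2) ∧
      ∑' m : ℕ, (lam ^ (α * ((m + k : ℕ) : ℝ)) * u (m + k)) ^ 2 ≤
        ∑' m : ℕ, lam ^ (2 * α * ((m : ℝ) + 1)) * u (m + 1) ^ 2 := by
  set F : ℕ → ℝ := fun n => (lam ^ (α * (n : ℝ)) * u n) ^ 2 with hF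
  have hshift : (fun m : ℕ => lam ^ (2 * α * ((m : ℝ) + 1)) * u (m + 1) ^ 2) =
      fun m => F (m + 1) := by
    funext m
    simp only [hF, mul_pow, ← Real.rpow_mul_natCast hlam.le]
    push_cast
    congr 2
    ring
  rw [hshift] at hu ⊢
  have hFs : Summable F := (summable_nat_add_iff 1).1 hu
  have hF0 : F 0 = 0 := by simp [hF, hu0]
  refine ⟨(summable_nat_add_iff k).2 hFs, ?_⟩
  have htotal : ∑' m, F m = ∑' m, F (m + 1) := by
    rw [hFs.tsum_eq_zero_add, hF0, zero_add]
  rw [← htotal]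
  exact tsum_comp_le_tsum_of_inj hFs (fun n => sq_nonneg _) (add_left_injective k)

/-- For `α ≥ 1/2` the shell coefficient `λᵖ` is absorbed by the weights `λ^{αj}` and `λ^{αk}`
as soon as `2p ≤ j + k + 2`. -/
theorem pow_le_mul_rpow_mul_rpow {lam α : ℝ} (hlam : 1 ≤ lam) (hα : 1 / 2 ≤ α) {p j k : ℕ}
    (h : 2 * p ≤ j + k + 2) :
    lam ^ p ≤ lam * (lam ^ (α * (j : ℝ)) * lam ^ (α * (k : ℝ))) := by
  have h0 : 0 < lam := by linarith
  have hcast : 2 * (p : ℝ) ≤ j + k + 2 := by exact_mod_cast h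
  have hjk : (0 : ℝ) ≤ (j : ℝ) + k := by positivity
  calc lam ^ p = lam ^ (p : ℝ) := (Real.rpow_natCast _ _).symm
    _ ≤ lam ^ (1 + (α * (j : ℝ) + α * (k : ℝ))) :=
        Real.rpow_le_rpow_of_exponent_le hlam (by nlinarith)
    _ = _ := by rw [Real.rpow_add h0, Real.rpow_add h0, Real.rpow_one]

/-- continuity of the dyadic shell-model trilinear form
`Σ_{n≥1} (−λⁿ u_{n−1} v_{n−1} + λ^{n+1} uₙ v_{n+1}) wₙ` for `λ > 1` and `α ≥ 1/2`, with a
constant `C` depending only on `λ`.  Sequences are indexed by `n ≥ 1` (encoded by the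
shift `n ↦ n+1`) with the convention `u₀ = v₀ = 0`. -/
theorem dyadic_trilinear_estimate (lam : ℝ) (hlam : 1 < lam) :
    ∃ C : ℝ, 0 < C ∧
      ∀ α : ℝ, (1 : ℝ) / 2 ≤ α →
      ∀ u v w : ℕ → ℝ, u 0 = 0 → v 0 = 0 →
        Summable (fun m : ℕ => lam ^ (2 * α * ((m : ℝ) + 1)) * u (m + 1) ^ 2) →
        Summable (fun m : ℕ => lam ^ (2 * α * ((m : ℝ) + 1)) * v (m + 1) ^ 2) →
        Summable (fun m : ℕ => w (m + 1) ^ 2) →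
        |∑' m : ℕ, (-(lam ^ (m + 1)) * u m * v m + lam ^ (m + 2) * u (m + 1) * v (m + 2))
            * w (m + 1)| ≤
          C * Real.sqrt (∑' m : ℕ, lam ^ (2 * α * ((m : ℝ) + 1)) * u (m + 1) ^ 2) *
            Real.sqrt (∑' m : ℕ, lam ^ (2 * α * ((m : ℝ) + 1)) * v (m + 1) ^ 2) *
            Real.sqrt (∑' m : ℕ, w (m + 1) ^ 2) := by
  have h0 : 0 < lam := by linarith
  refine ⟨2 * lam, by positivity, fun α hα u v w hu0 hv0 hu hv hw => ?_⟩
  set U := ∑' m : ℕ, lam ^ (2 * α * ((m : ℝ) + 1)) * u (m + 1) ^ 2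
  set V := ∑' m : ℕ, lam ^ (2 * α * ((m : ℝ) + 1)) * v (m + 1) ^ 2
  set W := ∑' m : ℕ, w (m + 1) ^ 2
  have htri : ∀ j k : ℕ,
      (Summable fun m : ℕ => |lam ^ (α * ((m + j : ℕ) : ℝ)) * u (m + j) *
        (lam ^ (α * ((m + k : ℕ) : ℝ)) * v (m + k)) * w (m + 1)|) ∧
      ∑' m : ℕ, |lam ^ (α * ((m + j : ℕ) : ℝ)) * u (m + j) *
        (lam ^ (α * ((m + k : ℕ) : ℝ)) * v (m + k)) * w (m + 1)| ≤ √U * √V * √W := by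
    intro j k
    obtain ⟨hfs, hfle⟩ := summable_weighted_shift_and_tsum_le h0 hu0 hu j
    obtain ⟨hgs, hgle⟩ := summable_weighted_shift_and_tsum_le h0 hv0 hv k
    obtain ⟨hs, hle⟩ := summable_abs_mul_mul_and_tsum_le hfs hgs hw
    refine ⟨hs, hle.trans ?_⟩
    gcongr
  have habsorb : ∀ p j k m : ℕ, 2 * p ≤ j + k + 2 →
      |lam ^ (m + p) * u (m + j) * v (m + k) * w (m + 1)| ≤
        lam * |lam ^ (α * ((m + j : ℕ) : ℝ)) * u (m + j) *
          (lam ^ (α * ((m + k : ℕ) : ℝ)) * v (m + k)) * w (m + 1)| := by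
    intro p j k m hp
    have hpow := pow_le_mul_rpow_mul_rpow hlam.le hα
      (show 2 * (m + p) ≤ (m + j) + (m + k) + 2 by omega)
    simp only [abs_mul, abs_of_pos (pow_pos h0 _), abs_of_pos (Real.rpow_pos_of_pos h0 _)]
    calc lam ^ (m + p) * |u (m + j)| * |v (m + k)| * |w (m + 1)|
        ≤ lam * (lam ^ (α * ((m + j : ℕ) : ℝ)) * lam ^ (α * ((m + k : ℕ) : ℝ))) *
            |u (m + j)| * |v (m + k)| * |w (m + 1)| := by gcongr
      _ = _ := by ring
  obtain ⟨hs₁, hle₁⟩ := htri 0 0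
  obtain ⟨hs₂, hle₂⟩ := htri 1 2
  rw [← Real.norm_eq_abs]
  refine (tsum_of_norm_bounded ((hs₁.mul_left lam).add (hs₂.mul_left lam)).hasSum
    fun m => ?_).trans ?_
  · rw [Real.norm_eq_abs]
    have hsplit : (-(lam ^ (m + 1)) * u m * v m + lam ^ (m + 2) * u (m + 1) * v (m + 2)) *
        w (m + 1) = -(lam ^ (m + 1) * u (m + 0) * v (m + 0) * w (m + 1)) +
          lam ^ (m + 2) * u (m + 1) * v (m + 2) * w (m + 1) := by
      simp only [add_zero]
      ring
    rw [hsplit]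
    refine (abs_add_le _ _).trans (add_le_add ?_ (habsorb 2 1 2 m (by norm_num)))
    rw [abs_neg]
    exact habsorb 1 0 0 m (by norm_num)
  · rw [(hs₁.mul_left lam).tsum_add (hs₂.mul_left lam), tsum_mul_left, tsum_mul_left]
    linarith [mul_le_mul_of_nonneg_left hle₁ h0.le, mul_le_mul_of_nonneg_left hle₂ h0.le]
end

section
/- Let n ∈ {2,3} and α = n/4. There exists a constant c > 0 such that for all smooth compactly supported vector fields u, v, w : ℝⁿ → ℝⁿ one has |b₁(u, v, w)| ≤ c · ‖u‖_{H¹} · ‖∇v‖_{L²}^{1−α} · ‖D²v‖_{L²}^{α} · ‖w‖_{L²}. -/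
open MeasureTheory

/-- The trilinear form `b₁(u,v,w) = Σ_{i,j} ∫_{ℝⁿ} uⁱ ∂ᵢvʲ wʲ`. -/
noncomputable def b1 {n : ℕ} (u v w : (Fin n → ℝ) → (Fin n → ℝ)) : ℝ :=
  ∑ i : Fin n, ∑ j : Fin n,
    ∫ x : Fin n → ℝ, u x i * fderiv ℝ v x (Pi.single i 1) j * w x j

/-- `‖u‖_{L²}²` of a vector field. -/
noncomputable def l2SqV {n : ℕ} (u : (Fin n → ℝ) → (Fin n → ℝ)) : ℝ :=
  ∫ x : Fin n → ℝ, ∑ j : Fin n, (u x j) ^ 2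

/-- `‖∇u‖_{L²}²` of a vector field (Frobenius norm of the Jacobian pointwise). -/
noncomputable def gradSqV {n : ℕ} (u : (Fin n → ℝ) → (Fin n → ℝ)) : ℝ :=
  ∫ x : Fin n → ℝ, ∑ i : Fin n, ∑ j : Fin n, (fderiv ℝ u x (Pi.single i 1) j) ^ 2

/-- `‖D²u‖_{L²}²` of a vector field (Frobenius norm of the Hessian pointwise). -/
noncomputable def hessSqV {n : ℕ} (u : (Fin n → ℝ) → (Fin n → ℝ)) : ℝ :=
  ∫ x : Fin n → ℝ, ∑ i : Fin n, ∑ j : Fin n, ∑ l : Fin n,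
    (fderiv ℝ (fun y => fderiv ℝ u y (Pi.single i 1) l) x (Pi.single j 1)) ^ 2

section CompactSupport

variable {n : ℕ} {f g : (Fin n → ℝ) → ℝ}

/-- The Cauchy–Schwarz inequality for continuous compactly supported functions. -/
lemma integral_abs_mul_le_sqrt_mul_sqrt (hf : Continuous f) (hfs : HasCompactSupport f)
    (hg : Continuous g) (hgs : HasCompactSupport g) :
    ∫ x, |f x * g x| ≤ √(∫ x, f x ^ 2) * √(∫ x, g x ^ 2) := by
  have h := integral_mul_norm_le_Lp_mul_Lq (μ := (volume : Measure (Fin n → ℝ)))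
    (f := f) (g := g) Real.HolderConjugate.two_two
    (hf.memLp_of_hasCompactSupport hfs) (hg.memLp_of_hasCompactSupport hgs)
  simpa [abs_mul, Real.sqrt_eq_rpow] using h

lemma HasCompactSupport.fun_pow {X : Type*} [TopologicalSpace X] {f : X → ℝ}
    (hf : HasCompactSupport f) {k : ℕ} (hk : k ≠ 0) : HasCompactSupport fun x => f x ^ k :=
  HasCompactSupport.comp_left (g := fun t : ℝ => t ^ k) hf (zero_pow hk)

lemma norm_sq_le_card_mul_sum_sq (L : (Fin n → ℝ) →L[ℝ] ℝ) :
    ‖L‖ ^ 2 ≤ n * ∑ i, L (Pi.single i 1) ^ 2 := by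
  have h : ‖L‖ ≤ ∑ i, |L (Pi.single i 1)| := by
    refine L.opNorm_le_bound (by positivity) fun x => ?_
    rw [← ContinuousLinearMap.coe_coe,
      LinearMap.pi_apply_eq_sum_univ (L : (Fin n → ℝ) →ₗ[ℝ] ℝ) x, Finset.sum_mul]
    refine (norm_sum_le _ _).trans (Finset.sum_le_sum fun i _ => ?_)
    rw [norm_smul, mul_comm]
    refine mul_le_mul (le_of_eq ?_) (norm_le_pi_norm x i) (norm_nonneg _) (abs_nonneg _)
    rw [Real.norm_eq_abs]
    congr 2
    ext j
    simp [Pi.single_apply, eq_comm]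
  calc ‖L‖ ^ 2 ≤ (∑ i, |L (Pi.single i 1)|) ^ 2 := by gcongr
    _ ≤ n * ∑ i, |L (Pi.single i 1)| ^ 2 := by
      simpa using sq_sum_le_card_mul_sum_sq (s := Finset.univ)
        (f := fun i => |L (Pi.single i 1)|)
    _ = _ := by simp

lemma continuous_fderiv_apply_of_contDiff (hf : ContDiff ℝ 1 f) (y : Fin n → ℝ) :
    Continuous fun x => fderiv ℝ f x y :=
  (hf.continuous_fderiv one_ne_zero).clm_apply continuous_const

lemma integrable_sum_sq {ι : Type*} [Fintype ι] {F : ι → (Fin n → ℝ) → ℝ}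
    (hF : ∀ i, Continuous (F i)) (hFs : ∀ i, HasCompactSupport (F i)) :
    Integrable fun x => ∑ i, F i x ^ 2 :=
  integrable_finsetSum _ fun i _ => ((hF i).pow 2).integrable_of_hasCompactSupport
    ((hFs i).fun_pow two_ne_zero)

lemma integral_norm_fderiv_sq_le (hf : ContDiff ℝ 1 f) (hfs : HasCompactSupport f) :
    ∫ x, ‖fderiv ℝ f x‖ ^ 2 ≤ n * ∫ x, ∑ i, fderiv ℝ f x (Pi.single i 1) ^ 2 := by
  rw [← integral_const_mul]
  refine integral_mono ?_ ((integrable_sum_sq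
    (F := fun i x => fderiv ℝ f x (Pi.single i 1))
    (fun i => continuous_fderiv_apply_of_contDiff hf _)
    (fun i => hfs.fderiv_apply ℝ _)).const_mul _) fun x => norm_sq_le_card_mul_sum_sq _
  exact ((hf.continuous_fderiv one_ne_zero).norm.pow 2).integrable_of_hasCompactSupport
    ((hfs.fderiv ℝ).norm.fun_pow two_ne_zero)

end CompactSupport

lemma integral_pow_four_le_two {f : (Fin 2 → ℝ) → ℝ} (hf : ContDiff ℝ 1 f)
    (hfs : HasCompactSupport f) :
    ∫ x, f x ^ 4 ≤ 8 * ((∫ x, f x ^ 2) * ∫ x, ∑ i, fderiv ℝ f x (Pi.single i 1) ^ 2) := by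
  have hg : ContDiff ℝ 1 fun x => f x ^ 2 := hf.pow 2
  have hgs : HasCompactSupport fun x => f x ^ 2 :=
    hfs.fun_pow two_ne_zero
  have hgi : Integrable fun x => ‖f x ^ 2‖ ^ (2 : ℝ) := by
    refine Continuous.integrable_of_hasCompactSupport (by fun_prop (disch := simp)) ?_
    exact hgs.comp_left (g := fun t : ℝ => ‖t‖ ^ (2 : ℝ)) (by simp)
  have hdi : Integrable fun x => fderiv ℝ (fun x => f x ^ 2) x :=
    (hg.continuous_fderiv one_ne_zero).integrable_of_hasCompactSupport (hgs.fderiv ℝ)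
  have key := lintegral_pow_le_pow_lintegral_fderiv_aux (ι := Fin 2) (p := 2)
    (by simpa using Real.HolderConjugate.two_two) hg hgs
  have h1 : ∫ x, f x ^ 4 ≤ (∫ x, ‖fderiv ℝ (fun x => f x ^ 2) x‖) ^ 2 := by
    rw [← ofReal_integral_norm_eq_lintegral_enorm hdi,
      ENNReal.ofReal_rpow_of_nonneg (by positivity) (by norm_num)] at key
    have : ∀ x, ‖f x ^ 2‖ₑ ^ (2 : ℝ) = ENNReal.ofReal (‖f x ^ 2‖ ^ (2 : ℝ)) := fun x => by
      rw [← ofReal_norm, ENNReal.ofReal_rpow_of_nonneg (by positivity) (by norm_num)]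
    simp_rw [this] at key
    rw [← ofReal_integral_eq_lintegral_ofReal hgi (ae_of_all _ fun x => by positivity),
      ENNReal.ofReal_le_ofReal_iff (by positivity)] at key
    simpa only [Real.rpow_two, Real.norm_eq_abs (_ ^ 2), sq_abs, ← pow_mul] using key
  have h2 : ∫ x, ‖fderiv ℝ (fun x => f x ^ 2) x‖ = 2 * ∫ x, |f x * ‖fderiv ℝ f x‖| := by
    rw [← integral_const_mul]
    congr with x
    rw [fderiv_fun_pow 2 (hf.differentiable one_ne_zero x)]
    simp [norm_smul, abs_mul, mul_assoc]
  have h3 := integral_abs_mul_le_sqrt_mul_sqrt hf.continuous hfs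
    (hf.continuous_fderiv one_ne_zero).norm (hfs.fderiv ℝ).norm
  have h4 := integral_norm_fderiv_sq_le hf hfs
  have hA : 0 ≤ ∫ x, f x ^ 2 := by positivity
  calc ∫ x, f x ^ 4 ≤ (2 * ∫ x, |f x * ‖fderiv ℝ f x‖|) ^ 2 := by rwa [← h2]
    _ ≤ (2 * (√(∫ x, f x ^ 2) * √(∫ x, ‖fderiv ℝ f x‖ ^ 2))) ^ 2 := by gcongr
    _ = 4 * ((∫ x, f x ^ 2) * ∫ x, ‖fderiv ℝ f x‖ ^ 2) := by
      rw [mul_pow, mul_pow, Real.sq_sqrt hA, Real.sq_sqrt (by positivity)]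
      norm_num
    _ ≤ 4 * ((∫ x, f x ^ 2) * ((2 : ℕ) * ∫ x, ∑ i, fderiv ℝ f x (Pi.single i 1) ^ 2)) := by
      gcongr
    _ = _ := by push_cast; ring

lemma exists_integral_pow_four_le_three : ∃ C : ℝ, 0 ≤ C ∧ ∀ f : (Fin 3 → ℝ) → ℝ,
    ContDiff ℝ 1 f → HasCompactSupport f →
    ∫ x, f x ^ 4 ≤
      C * (√(∫ x, f x ^ 2) * √(∫ x, ∑ i, fderiv ℝ f x (Pi.single i 1) ^ 2) ^ 3) := by
  set K : NNReal :=
    eLpNormLESNormFDerivOfEqInnerConst (volume : Measure (Fin 3 → ℝ)) 2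
  refine ⟨(K * √3) ^ 3, by positivity, fun f hf hfs => ?_⟩
  have key := eLpNorm_le_eLpNorm_fderiv_of_eq_inner (volume : Measure (Fin 3 → ℝ)) hf hfs
    (p := 2) (p' := 6) (by norm_num) (by simp) (by simp; norm_num)
  have hf6 : MemLp f 6 := hf.continuous.memLp_of_hasCompactSupport hfs
  have hd2 : MemLp (fderiv ℝ f) 2 :=
    (hf.continuous_fderiv one_ne_zero).memLp_of_hasCompactSupport (hfs.fderiv ℝ)
  have h1 : (∫ x, f x ^ 6) ^ (6⁻¹ : ℝ) ≤ K * √(∫ x, ‖fderiv ℝ f x‖ ^ 2) := by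
    have e6 : eLpNorm f ((6 : NNReal) : ENNReal) volume
        = ENNReal.ofReal ((∫ x, f x ^ 6) ^ (6⁻¹ : ℝ)) := by
      have := hf6.eLpNorm_eq_integral_rpow_norm (by norm_num) (by norm_num)
      have e : ∀ x, |f x| ^ 6 = f x ^ 6 := fun x => Even.pow_abs (by decide) _
      simpa [e] using this
    have e2 : eLpNorm (fderiv ℝ f) ((2 : NNReal) : ENNReal) volume
        = ENNReal.ofReal (√(∫ x, ‖fderiv ℝ f x‖ ^ 2)) := by
      have := hd2.eLpNorm_eq_integral_rpow_norm (by norm_num) (by norm_num)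
      simpa [Real.sqrt_eq_rpow] using this
    rw [e6, e2, ← ENNReal.ofReal_coe_nnreal, ← ENNReal.ofReal_mul (by positivity),
      ENNReal.ofReal_le_ofReal_iff (by positivity)] at key
    exact key
  have h6 : 0 ≤ ∫ x, f x ^ 6 := integral_nonneg fun x => Even.pow_nonneg (by decide) _
  have h2 : √(∫ x, f x ^ 6) = ((∫ x, f x ^ 6) ^ (6⁻¹ : ℝ)) ^ 3 := by
    rw [Real.sqrt_eq_rpow, ← Real.rpow_mul_natCast h6]
    norm_num
  have h3 := integral_abs_mul_le_sqrt_mul_sqrt (g := fun x => f x ^ 3)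
    hf.continuous hfs (hf.continuous.pow 3)
    (hfs.fun_pow three_ne_zero)
  have h4 := integral_norm_fderiv_sq_le hf hfs
  have e4 : ∀ x, |f x * f x ^ 3| = f x ^ 4 := fun x => by
    rw [← pow_succ', abs_of_nonneg (Even.pow_nonneg (by decide) _)]
  simp only [e4, ← pow_mul] at h3
  calc ∫ x, f x ^ 4 ≤ √(∫ x, f x ^ 2) * √(∫ x, f x ^ 6) := h3
    _ ≤ √(∫ x, f x ^ 2) * (K * √((3 : ℕ) *
          ∫ x, ∑ i, fderiv ℝ f x (Pi.single i 1) ^ 2)) ^ 3 := by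
      rw [h2]
      gcongr
      exact h1.trans (by gcongr)
    _ = _ := by
      rw [Real.sqrt_mul (by positivity)]
      push_cast
      ring

/-- Ladyzhenskaya's inequality in dimensions two and three. -/
lemma exists_ladyzhenskaya {n : ℕ} (hn : n = 2 ∨ n = 3) : ∃ C : ℝ, 0 < C ∧
    ∀ f : (Fin n → ℝ) → ℝ, ContDiff ℝ 1 f → HasCompactSupport f →
    √√(∫ x, f x ^ 4) ≤ C * (√(∫ x, f x ^ 2) ^ (1 - (n : ℝ) / 4) *
      √(∫ x, ∑ i, fderiv ℝ f x (Pi.single i 1) ^ 2) ^ ((n : ℝ) / 4)) := by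
  obtain ⟨C, hC, h⟩ : ∃ C : ℝ, 0 ≤ C ∧ ∀ f : (Fin n → ℝ) → ℝ,
      ContDiff ℝ 1 f → HasCompactSupport f →
      ∫ x, f x ^ 4 ≤ C * (√(∫ x, f x ^ 2) ^ (4 - (n : ℝ)) *
        √(∫ x, ∑ i, fderiv ℝ f x (Pi.single i 1) ^ 2) ^ (n : ℝ)) := by
    rcases hn with rfl | rfl
    · refine ⟨8, by norm_num, fun f hf hfs => (integral_pow_four_le_two hf hfs).trans_eq ?_⟩
      norm_num
      rw [Real.sq_sqrt (by positivity), Real.sq_sqrt (by positivity)]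
    · obtain ⟨C, hC, h⟩ := exists_integral_pow_four_le_three
      refine ⟨C, hC, fun f hf hfs => (h f hf hfs).trans_eq ?_⟩
      norm_num
  refine ⟨√√(C + 1), by positivity, fun f hf hfs => ?_⟩
  set A := √(∫ x, f x ^ 2)
  set B := √(∫ x, ∑ i, fderiv ℝ f x (Pi.single i 1) ^ 2)
  have hA : 0 ≤ A := Real.sqrt_nonneg _
  have hB : 0 ≤ B := Real.sqrt_nonneg _
  have e : A ^ (4 - (n : ℝ)) * B ^ (n : ℝ) =
      ((A ^ (1 - (n : ℝ) / 4) * B ^ ((n : ℝ) / 4)) ^ 2) ^ 2 := by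
    rw [← pow_mul, mul_pow, ← Real.rpow_mul_natCast hA, ← Real.rpow_mul_natCast hB]
    congr 2 <;> push_cast <;> ring
  have h' := h f hf hfs
  rw [e] at h'
  calc √√(∫ x, f x ^ 4)
      ≤ √√((C + 1) * ((A ^ (1 - (n : ℝ) / 4) * B ^ ((n : ℝ) / 4)) ^ 2) ^ 2) := by
        gcongr
        exact h'.trans (by gcongr; linarith)
    _ = _ := by
      rw [Real.sqrt_mul (by positivity), Real.sqrt_sq (by positivity),
        Real.sqrt_mul (by positivity), Real.sqrt_sq (by positivity)]

/-- Hölder's inequality with exponents `4`, `4`, `2`. -/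
lemma abs_integral_mul_mul_le {n : ℕ} {f g h : (Fin n → ℝ) → ℝ}
    (hf : Continuous f) (hfs : HasCompactSupport f) (hg : Continuous g)
    (hgs : HasCompactSupport g) (hh : Continuous h) (hhs : HasCompactSupport h) :
    |∫ x, f x * g x * h x| ≤
      √√(∫ x, f x ^ 4) * √√(∫ x, g x ^ 4) * √(∫ x, h x ^ 2) := by
  have h1 := integral_abs_mul_le_sqrt_mul_sqrt (hf.mul hg) (hfs.mul_right (f' := g)) hh hhs
  have h2 := integral_abs_mul_le_sqrt_mul_sqrt (f := fun x => f x ^ 2) (g := fun x => g x ^ 2)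
    (hf.pow 2)
    (hfs.fun_pow two_ne_zero) (hg.pow 2)
    (hgs.fun_pow two_ne_zero)
  have e : ∀ x, |f x ^ 2 * g x ^ 2| = (f x * g x) ^ 2 := fun x => by
    rw [← mul_pow, abs_of_nonneg (sq_nonneg _)]
  simp only [e, ← pow_mul] at h2
  calc |∫ x, f x * g x * h x| ≤ ∫ x, |f x * g x * h x| := abs_integral_le_integral_abs
    _ ≤ √(∫ x, (f x * g x) ^ 2) * √(∫ x, h x ^ 2) := h1
    _ ≤ √(√(∫ x, f x ^ 4) * √(∫ x, g x ^ 4)) * √(∫ x, h x ^ 2) := by gcongr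
    _ = _ := by rw [Real.sqrt_mul (by positivity)]

/-- with `α = n/4`, `n ∈ {2,3}`, there is `c > 0` such that
`|b₁(u,v,w)| ≤ c ‖u‖_{H¹} ‖∇v‖_{L²}^{1−α} ‖D²v‖_{L²}^{α} ‖w‖_{L²}` for all smooth
compactly supported vector fields. -/
theorem b1_estimate_H1 {n : ℕ} (hn : n = 2 ∨ n = 3) :
    ∃ c : ℝ, 0 < c ∧
      ∀ u v w : (Fin n → ℝ) → (Fin n → ℝ),
        ContDiff ℝ (⊤ : ℕ∞) u → HasCompactSupport u →
        ContDiff ℝ (⊤ : ℕ∞) v → HasCompactSupport v →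
        ContDiff ℝ (⊤ : ℕ∞) w → HasCompactSupport w →
        |b1 u v w| ≤
          c * Real.sqrt (l2SqV u + gradSqV u) *
            Real.sqrt (gradSqV v) ^ (1 - (n : ℝ) / 4) *
            Real.sqrt (hessSqV v) ^ ((n : ℝ) / 4) *
            Real.sqrt (l2SqV w) := by
  obtain ⟨C, hC, hL⟩ := exists_ladyzhenskaya hn
  have hα : (n : ℝ) / 4 ≤ 1 := by rcases hn with rfl | rfl <;> norm_num
  have hα0 : 0 ≤ (n : ℝ) / 4 := by positivity
  have hn0 : (0 : ℝ) < n := by rcases hn with rfl | rfl <;> norm_num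
  refine ⟨n * (n * (C * C)), by positivity, fun u v w hu hus hv hvs hw hws => ?_⟩
  have comp : ∀ z : (Fin n → ℝ) → Fin n → ℝ, HasCompactSupport z → ∀ j,
      HasCompactSupport fun x => z x j := fun z hz j =>
    HasCompactSupport.comp_left (g := fun y : Fin n → ℝ => y j) hz rfl
  have dcomp : ∀ z : (Fin n → ℝ) → Fin n → ℝ, ContDiff ℝ (⊤ : ℕ∞) z → ∀ i j x,
      fderiv ℝ (fun y => z y j) x (Pi.single i 1) = fderiv ℝ z x (Pi.single i 1) j := by
    intro z hz i j x
    rw [fderiv_apply (hz.differentiable (by simp) x)]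
    rfl
  have hdv : ∀ i j, ContDiff ℝ 1 fun x => fderiv ℝ v x (Pi.single i 1) j := fun i j =>
    contDiff_pi.1 ((hv.fderiv_right (m := 1) (by norm_cast)).clm_apply contDiff_const) j
  have hdvs : ∀ i j, HasCompactSupport fun x => fderiv ℝ v x (Pi.single i 1) j := fun i j =>
    comp _ (hvs.fderiv_apply ℝ _) j
  have hdu : ∀ i j, Continuous fun x => fderiv ℝ u x (Pi.single i 1) j := fun i j =>
    continuous_pi_iff.1 ((hu.continuous_fderiv (by simp)).clm_apply continuous_const) j
  have hdus : ∀ i j, HasCompactSupport fun x => fderiv ℝ u x (Pi.single i 1) j := fun i j =>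
    comp _ (hus.fderiv_apply ℝ _) j
  have hu' : ∀ i, ContDiff ℝ 1 fun x => u x i := fun i =>
    contDiff_pi.1 (hu.of_le (by norm_cast)) i
  have hw' : ∀ i, Continuous fun x => w x i := fun i => continuous_pi_iff.1 hw.continuous i
  have l2 : ∀ z : (Fin n → ℝ) → Fin n → ℝ, (∀ i, Continuous fun x => z x i) →
      HasCompactSupport z → ∀ j, ∫ x, z x j ^ 2 ≤ l2SqV z := fun z hz hzs j =>
    integral_mono (((hz j).pow 2).integrable_of_hasCompactSupport
      ((comp z hzs j).fun_pow two_ne_zero)) (integrable_sum_sq hz (comp z hzs)) fun x =>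
      Finset.single_le_sum (f := fun i => z x i ^ 2) (fun i _ => sq_nonneg _)
        (Finset.mem_univ j)
  have hgu : ∀ j, ∫ x, ∑ i, fderiv ℝ (fun y => u y j) x (Pi.single i 1) ^ 2 ≤ gradSqV u := by
    intro j
    simp_rw [dcomp u hu]
    refine integral_mono (integrable_sum_sq (fun i => hdu i j) fun i => hdus i j)
      (integrable_finsetSum _ fun i _ => integrable_sum_sq (hdu i) (hdus i)) fun x => ?_
    exact Finset.sum_le_sum fun i _ => Finset.single_le_sum
      (f := fun j => fderiv ℝ u x (Pi.single i 1) j ^ 2) (fun i _ => sq_nonneg _)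
      (Finset.mem_univ j)
  have hgv : ∀ i j, ∫ x, fderiv ℝ v x (Pi.single i 1) j ^ 2 ≤ gradSqV v := by
    intro i j
    refine integral_mono (((hdv i j).continuous.pow 2).integrable_of_hasCompactSupport
      ((hdvs i j).fun_pow two_ne_zero)) (integrable_finsetSum _ fun i _ =>
        integrable_sum_sq (fun j => (hdv i j).continuous) (hdvs i)) fun x => ?_
    exact (Finset.single_le_sum (f := fun j => fderiv ℝ v x (Pi.single i 1) j ^ 2)
      (fun i _ => sq_nonneg _) (Finset.mem_univ j)).trans (Finset.single_le_sum
      (f := fun i => ∑ j, fderiv ℝ v x (Pi.single i 1) j ^ 2)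
      (fun i _ => Finset.sum_nonneg fun j _ => sq_nonneg _) (Finset.mem_univ i))
  have hHv : ∀ i j, ∫ x, ∑ k, fderiv ℝ (fun y => fderiv ℝ v y (Pi.single i 1) j) x
      (Pi.single k 1) ^ 2 ≤ hessSqV v := by
    intro i j
    have hc : ∀ i j k, Continuous fun x => fderiv ℝ (fun y => fderiv ℝ v y (Pi.single i 1) j) x
        (Pi.single k 1) := fun i j k => continuous_fderiv_apply_of_contDiff (hdv i j) _
    have hcs : ∀ i j k, HasCompactSupport fun x =>
        fderiv ℝ (fun y => fderiv ℝ v y (Pi.single i 1) j) x (Pi.single k 1) :=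
      fun i j k => (hdvs i j).fderiv_apply ℝ _
    refine integral_mono (integrable_sum_sq (hc i j) (hcs i j))
      (integrable_finsetSum _ fun i _ => integrable_finsetSum _ fun k _ =>
        integrable_sum_sq (fun l => hc i l k) (fun l => hcs i l k)) fun x => ?_
    exact (Finset.sum_le_sum fun k _ => Finset.single_le_sum
      (f := fun l => fderiv ℝ (fun y => fderiv ℝ v y (Pi.single i 1) l) x (Pi.single k 1) ^ 2)
      (fun l _ => sq_nonneg _) (Finset.mem_univ j)).trans (Finset.single_le_sum
      (f := fun i => ∑ k, ∑ l,
        fderiv ℝ (fun y => fderiv ℝ v y (Pi.single i 1) l) x (Pi.single k 1) ^ 2)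
      (fun i _ => Finset.sum_nonneg fun j _ => Finset.sum_nonneg fun l _ => sq_nonneg _)
      (Finset.mem_univ i))
  have hl0 : 0 ≤ l2SqV u := integral_nonneg fun x => Finset.sum_nonneg fun i _ => sq_nonneg _
  have hg0 : 0 ≤ gradSqV u := integral_nonneg fun x =>
    Finset.sum_nonneg fun i _ => Finset.sum_nonneg fun j _ => sq_nonneg _
  set H := √(l2SqV u + gradSqV u)
  have hu4 : ∀ i, √√(∫ x, u x i ^ 4) ≤ C * H := by
    intro i
    calc √√(∫ x, u x i ^ 4) ≤ _ := hL _ (hu' i) (comp u hus i)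
      _ ≤ C * (H ^ (1 - (n : ℝ) / 4) * H ^ ((n : ℝ) / 4)) := by
        gcongr
        · refine Real.sqrt_le_sqrt ?_
          exact (l2 u (fun i => (hu' i).continuous) hus i).trans (by linarith)
        · refine Real.sqrt_le_sqrt ?_
          exact (hgu i).trans (by linarith)
      _ = C * H := by
        rw [← Real.rpow_add_of_nonneg (Real.sqrt_nonneg _) (by linarith) hα0]
        rw [sub_add_cancel, Real.rpow_one]
  have hv4 : ∀ i j, √√(∫ x, fderiv ℝ v x (Pi.single i 1) j ^ 4) ≤
      C * (√(gradSqV v) ^ (1 - (n : ℝ) / 4) * √(hessSqV v) ^ ((n : ℝ) / 4)) := by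
    intro i j
    refine (hL _ (hdv i j) (hdvs i j)).trans ?_
    gcongr
    · exact hgv i j
    · exact hHv i j
  set V := √(gradSqV v) ^ (1 - (n : ℝ) / 4) * √(hessSqV v) ^ ((n : ℝ) / 4) with hV
  have hterm : ∀ i j, |∫ x, u x i * fderiv ℝ v x (Pi.single i 1) j * w x j| ≤
      C * H * (C * V) * √(l2SqV w) := by
    intro i j
    refine (abs_integral_mul_mul_le (hu' i).continuous (comp u hus i) (hdv i j).continuous
      (hdvs i j) (hw' j) (comp w hws j)).trans ?_
    gcongr
    · exact hu4 i
    · exact hv4 i j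
    · exact l2 w hw' hws j
  calc |b1 u v w|
      ≤ ∑ i : Fin n, ∑ j : Fin n, |∫ x, u x i * fderiv ℝ v x (Pi.single i 1) j * w x j| :=
        (Finset.abs_sum_le_sum_abs _ _).trans
          (Finset.sum_le_sum fun i _ => Finset.abs_sum_le_sum_abs _ _)
    _ ≤ ∑ i : Fin n, ∑ j : Fin n, C * H * (C * V) * √(l2SqV w) :=
        Finset.sum_le_sum fun i _ => Finset.sum_le_sum fun j _ => hterm i j
    _ = _ := by
        simp only [Finset.sum_const, Finset.card_univ, Fintype.card_fin, nsmul_eq_mul, hV]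
        ring
end

section
/- Let n ∈ {2,3} and α = n/4. There exists a constant c > 0 such that for every smooth compactly supported vector field u : ℝⁿ → ℝⁿ and all smooth compactly supported scalar functions θ, ψ : ℝⁿ → ℝ one has |b₂(u, θ, ψ)| ≤ c · ‖u‖_{H¹} · ‖∇θ‖_{L²}^{1−α} · ‖D²θ‖_{L²}^{α} · ‖ψ‖_{L²}. -/
open MeasureTheory

/-- The trilinear form `b₂(u,θ,ψ) = Σ_i ∫_{ℝⁿ} uⁱ ∂ᵢθ ψ`. -/
noncomputable def b2 {n : ℕ} (u : (Fin n → ℝ) → (Fin n → ℝ))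
    (θ ψ : (Fin n → ℝ) → ℝ) : ℝ :=
  ∑ i : Fin n, ∫ x : Fin n → ℝ, u x i * fderiv ℝ θ x (Pi.single i 1) * ψ x

/-- `‖θ‖_{L²}²` of a scalar function. -/
noncomputable def l2SqS {n : ℕ} (θ : (Fin n → ℝ) → ℝ) : ℝ :=
  ∫ x : Fin n → ℝ, (θ x) ^ 2

/-- `‖∇θ‖_{L²}²` of a scalar function. -/
noncomputable def gradSqS {n : ℕ} (θ : (Fin n → ℝ) → ℝ) : ℝ :=
  ∫ x : Fin n → ℝ, ∑ i : Fin n, (fderiv ℝ θ x (Pi.single i 1)) ^ 2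

/-- `‖D²θ‖_{L²}²` of a scalar function (Frobenius norm of the Hessian pointwise). -/
noncomputable def hessSqS {n : ℕ} (θ : (Fin n → ℝ) → ℝ) : ℝ :=
  ∫ x : Fin n → ℝ, ∑ i : Fin n, ∑ j : Fin n,
    (fderiv ℝ (fun y => fderiv ℝ θ y (Pi.single i 1)) x (Pi.single j 1)) ^ 2

/-- The **Cauchy–Schwarz inequality** for integrals of real functions. -/
theorem sq_integral_mul_le {α : Type*} [MeasurableSpace α] {μ : Measure α} {f g : α → ℝ}
    (hf : Integrable (fun x => f x ^ 2) μ) (hg : Integrable (fun x => g x ^ 2) μ)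
    (hfg : Integrable (fun x => f x * g x) μ) :
    (∫ x, f x * g x ∂μ) ^ 2 ≤ (∫ x, f x ^ 2 ∂μ) * ∫ x, g x ^ 2 ∂μ := by
  have key : ∀ t : ℝ, 0 ≤ (∫ x, f x ^ 2 ∂μ) * (t * t) + (2 * ∫ x, f x * g x ∂μ) * t
      + ∫ x, g x ^ 2 ∂μ := by
    intro t
    have h : ∫ x, (t * f x + g x) ^ 2 ∂μ = (∫ x, f x ^ 2 ∂μ) * (t * t)
        + (2 * ∫ x, f x * g x ∂μ) * t + ∫ x, g x ^ 2 ∂μ := by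
      have e : (fun x => (t * f x + g x) ^ 2)
          = fun x => (t * t) * f x ^ 2 + (2 * t) * (f x * g x) + g x ^ 2 := by
        funext x; ring
      have h1 : Integrable (fun x => (t * t) * f x ^ 2) μ := hf.const_mul _
      have h2 : Integrable (fun x => (2 * t) * (f x * g x)) μ := hfg.const_mul _
      have h12 : Integrable (fun x => (t * t) * f x ^ 2 + (2 * t) * (f x * g x)) μ := h1.add h2
      rw [e, integral_add h12 hg, integral_add h1 h2, integral_const_mul, integral_const_mul]
      ring
    rw [← h]
    exact integral_nonneg fun x => sq_nonneg _
  have := discrim_le_zero key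
  rw [discrim] at this
  nlinarith

/-- The squared operator norm, for the sup norm on `ℝⁿ`, of a linear form is at most `n` times
the sum of the squares of its coefficients. -/
theorem sq_norm_le_card_mul_sum_sq {n : ℕ} (L : (Fin n → ℝ) →L[ℝ] ℝ) :
    ‖L‖ ^ 2 ≤ n * ∑ i, (L (Pi.single i 1)) ^ 2 := by
  have h : ‖L‖ ≤ ∑ i, |L (Pi.single i 1)| := by
    refine L.opNorm_le_bound (by positivity) fun v => ?_
    have hv : L v = ∑ i, v i * L (Pi.single i 1) := by
      conv_lhs => rw [pi_eq_sum_univ' v]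
      simp [map_sum]
    rw [hv, Finset.sum_mul]
    refine (Finset.abs_sum_le_sum_abs _ _).trans (Finset.sum_le_sum fun i _ => ?_)
    rw [abs_mul, mul_comm]
    gcongr
    exact norm_le_pi_norm v i
  calc ‖L‖ ^ 2 ≤ (∑ i, |L (Pi.single i 1)|) ^ 2 := by gcongr
    _ ≤ _ := by
      simpa using sq_sum_le_card_mul_sum_sq (s := Finset.univ) (f := fun i => |L (Pi.single i 1)|)

/-- Real-valued form of the Gagliardo–Nirenberg–Sobolev inequality with exponent `1`. -/
theorem integral_norm_rpow_le_integral_norm_fderiv_rpow {n : ℕ} {p : ℝ}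
    (hp : Real.HolderConjugate n p) {v : (Fin n → ℝ) → ℝ} (hv : ContDiff ℝ 1 v)
    (hv' : HasCompactSupport v) :
    ∫ x, |v x| ^ p ≤ (∫ x, ‖fderiv ℝ v x‖) ^ p := by
  have hp0 : 0 < p := hp.symm.pos
  have h := lintegral_pow_le_pow_lintegral_fderiv_aux (ι := Fin n) (p := p) (by simpa using hp)
    hv hv'
  have hD : Integrable (fderiv ℝ v) :=
    (hv.continuous_fderiv one_ne_zero).integrable_of_hasCompactSupport (hv'.fderiv ℝ)
  have hc := hv.continuous
  rw [← ofReal_integral_norm_eq_lintegral_enorm hD,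
    ENNReal.ofReal_rpow_of_nonneg (integral_nonneg fun _ => norm_nonneg _) hp0.le] at h
  rw [integral_eq_lintegral_of_nonneg_ae (.of_forall fun x => by positivity)
    (hc.abs.rpow_const fun _ => Or.inr hp0.le).aestronglyMeasurable]
  refine ENNReal.toReal_le_of_le_ofReal (by positivity) (le_trans (le_of_eq ?_) h)
  refine lintegral_congr fun x => ?_
  rw [← ENNReal.ofReal_rpow_of_nonneg (abs_nonneg _) hp0.le, ← Real.norm_eq_abs,
    ofReal_norm]

/-- Powers of a continuous compactly supported function are integrable. -/
theorem Continuous.integrable_pow_of_hasCompactSupport {n : ℕ} {v : (Fin n → ℝ) → ℝ}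
    (hv : Continuous v) (hv' : HasCompactSupport v) {k : ℕ} (hk : k ≠ 0) :
    Integrable fun x => v x ^ k :=
  (hv.pow k).integrable_of_hasCompactSupport
    (hv'.comp_left (g := fun y : ℝ => y ^ k) (zero_pow hk))

/-- **Ladyzhenskaya's inequality** in dimensions two and three. -/
theorem sq_integral_pow_four_le {n : ℕ} (hn : n = 2 ∨ n = 3) {f : (Fin n → ℝ) → ℝ}
    (hf : ContDiff ℝ 1 f) (hf' : HasCompactSupport f) :
    (∫ x, f x ^ 4) ^ 2 ≤ 110592 * l2SqS f ^ (4 - n) * gradSqS f ^ n := by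
  have hc : Continuous f := hf.continuous
  have hDc : Continuous (fderiv ℝ f) := hf.continuous_fderiv one_ne_zero
  have hD' : HasCompactSupport (fderiv ℝ f) := hf'.fderiv ℝ
  have hpow : ∀ k : ℕ, k ≠ 0 → Integrable fun x => f x ^ k := fun k hk =>
    hc.integrable_pow_of_hasCompactSupport hf' hk
  have hDD : Integrable fun x => ‖fderiv ℝ f x‖ ^ 2 :=
    hDc.norm.integrable_pow_of_hasCompactSupport hD'.norm two_ne_zero
  have hprod : ∀ k : ℕ, Integrable fun x => |f x| ^ k * ‖fderiv ℝ f x‖ := fun k =>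
    ((hc.abs.pow k).mul hDc.norm).integrable_of_hasCompactSupport
      (hD'.norm.mul_left)
  have hgrad : ∫ x, ‖fderiv ℝ f x‖ ^ 2 ≤ n * gradSqS f := by
    rw [gradSqS, ← integral_const_mul]
    refine integral_mono hDD ?_ fun x => sq_norm_le_card_mul_sum_sq _
    refine Integrable.const_mul (integrable_finsetSum _ fun i _ => ?_) _
    exact (hDc.clm_apply continuous_const).integrable_pow_of_hasCompactSupport
      (hf'.fderiv_apply ℝ (Pi.single i 1)) two_ne_zero
  have hA : 0 ≤ l2SqS f := integral_nonneg fun _ => sq_nonneg _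
  have hB : 0 ≤ gradSqS f := integral_nonneg fun _ => by positivity
  have hD0 : 0 ≤ ∫ x, ‖fderiv ℝ f x‖ ^ 2 := integral_nonneg fun _ => by positivity
  have hT0 : ∀ k : ℕ, 0 ≤ ∫ x, |f x| ^ k * ‖fderiv ℝ f x‖ :=
    fun k => integral_nonneg fun _ => by positivity
  have hderiv : ∀ k : ℕ, ∫ x, ‖fderiv ℝ (fun y => f y ^ (k + 1)) x‖
      = (k + 1) * ∫ x, |f x| ^ k * ‖fderiv ℝ f x‖ := by
    intro k
    rw [← integral_const_mul]
    refine integral_congr_ae (.of_forall fun x => ?_)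
    have := ((hf.differentiable one_ne_zero x).hasFDerivAt.pow (k + 1)).fderiv
    simp only [this, norm_smul]
    simp [abs_of_nonneg (by positivity : (0 : ℝ) ≤ (k : ℝ) + 1)]
    ring
  have hcs : ∀ k : ℕ, k ≠ 0 → (∫ x, |f x| ^ k * ‖fderiv ℝ f x‖) ^ 2
      ≤ (∫ x, f x ^ (2 * k)) * ∫ x, ‖fderiv ℝ f x‖ ^ 2 := by
    intro k hk
    have e : ∀ x, (|f x| ^ k) ^ 2 = f x ^ (2 * k) := fun x => by
      rw [← pow_mul, mul_comm k, pow_mul, sq_abs, ← pow_mul]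
    have := sq_integral_mul_le (f := fun x => |f x| ^ k) (g := fun x => ‖fderiv ℝ f x‖)
      (by simpa only [e] using hpow (2 * k) (by omega)) hDD (hprod k)
    simpa only [e] using this
  have hsob : ∀ {p : ℝ} (k : ℕ), Real.HolderConjugate n p →
      ∫ x, |f x ^ (k + 1)| ^ p ≤ ((k + 1) * ∫ x, |f x| ^ k * ‖fderiv ℝ f x‖) ^ p := by
    intro p k hp
    rw [← hderiv]
    exact integral_norm_rpow_le_integral_norm_fderiv_rpow hp (hf.pow (k + 1))
      (hf'.comp_left (g := fun y : ℝ => y ^ (k + 1)) (by simp))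
  have hX0 : 0 ≤ ∫ x, f x ^ 4 := integral_nonneg fun _ => by positivity
  rcases hn with rfl | rfl
  · have h := hsob (p := 2) 1 (by rw [Real.holderConjugate_iff]; norm_num)
    have h1 := hcs 1 one_ne_zero
    have e : ∀ x, |f x ^ (1 + 1)| ^ (2 : ℝ) = f x ^ 4 := fun x => by
      rw [Real.rpow_two, sq_abs]; ring
    simp only [e, Real.rpow_two] at h
    norm_num at h h1 hgrad
    have hA' : ∫ x, f x ^ 2 = l2SqS f := rfl
    rw [hA'] at h1
    have h3 : ∫ x, f x ^ 4 ≤ 8 * (l2SqS f * gradSqS f) := by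
      nlinarith [mul_le_mul_of_nonneg_left hgrad hA]
    calc _ ≤ (8 * (l2SqS f * gradSqS f)) ^ 2 := pow_le_pow_left₀ hX0 h3 2
      _ = 64 * (l2SqS f ^ 2 * gradSqS f ^ 2) := by ring
      _ ≤ 110592 * (l2SqS f ^ 2 * gradSqS f ^ 2) := by gcongr; norm_num
      _ = _ := by ring
  · have h := hsob (p := 3 / 2) 3 (by rw [Real.holderConjugate_iff]; norm_num)
    have h1 := hcs 3 (by norm_num)
    have e : ∀ x, |f x ^ (3 + 1)| ^ (3 / 2 : ℝ) = f x ^ 6 := fun x => by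
      have : |f x ^ (3 + 1)| = |f x| ^ (4 : ℝ) := by rw [abs_pow]; norm_cast
      rw [this, ← Real.rpow_mul (abs_nonneg _)]
      norm_num
      exact Even.pow_abs (by decide) _
    simp only [e] at h
    norm_num at h h1 hgrad
    have hS0 : 0 ≤ ∫ x, f x ^ 6 := integral_nonneg fun _ => by positivity
    have hint : (∫ x, f x ^ 4) ^ 2 ≤ l2SqS f * ∫ x, f x ^ 6 := by
      have e1 : ∀ x, f x * f x ^ 3 = f x ^ 4 := fun x => by ring
      have e2 : ∀ x, (f x ^ 3) ^ 2 = f x ^ 6 := fun x => by ring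
      have := sq_integral_mul_le (μ := volume) (f := f) (g := fun x => f x ^ 3)
        (hpow 2 (by norm_num)) (by simpa only [e2] using hpow 6 (by norm_num))
        (by simpa only [e1] using hpow 4 (by norm_num))
      simp only [e1, e2] at this
      exact this
    set S := ∫ x, f x ^ 6
    set T := ∫ x, |f x| ^ 3 * ‖fderiv ℝ f x‖
    set D := ∫ x, ‖fderiv ℝ f x‖ ^ 2
    have hT : 0 ≤ T := hT0 3
    have h2 : S ^ 2 ≤ 64 * T ^ 3 := by
      have h' := pow_le_pow_left₀ hS0 h 2
      rw [← Real.rpow_natCast (_ ^ (3 / 2 : ℝ)), ← Real.rpow_mul (by positivity)] at h'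
      norm_num at h'
      linarith [h', mul_pow 4 T 3]
    have h3 : S ≤ 4096 * D ^ 3 := by
      rcases hS0.eq_or_lt with h0 | h0
      · rw [← h0]; positivity
      · refine le_of_mul_le_mul_left ?_ (pow_pos h0 3)
        have a := pow_le_pow_left₀ (sq_nonneg S) h2 2
        have b := pow_le_pow_left₀ (sq_nonneg T) h1 3
        nlinarith
    have h4 : D ^ 3 ≤ 27 * gradSqS f ^ 3 := by
      have := pow_le_pow_left₀ hD0 hgrad 3
      linarith [this, mul_pow 3 (gradSqS f) 3]
    calc _ ≤ l2SqS f * S := hint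
      _ ≤ l2SqS f * (110592 * gradSqS f ^ 3) := by gcongr; linarith
      _ = _ := by norm_num; ring

/-- Hölder's inequality with exponents `4, 4, 2`, raised to the power `8`. -/
theorem integral_mul_mul_pow_eight_le {n : ℕ} {f g h : (Fin n → ℝ) → ℝ}
    (hf : Continuous f) (hf' : HasCompactSupport f) (hg : Continuous g)
    (hg' : HasCompactSupport g) (hh : Continuous h) (hh' : HasCompactSupport h) :
    (∫ x, f x * g x * h x) ^ 8
      ≤ (∫ x, f x ^ 4) ^ 2 * (∫ x, g x ^ 4) ^ 2 * l2SqS h ^ 4 := by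
  have hfg' : HasCompactSupport fun x => f x * g x := hf'.mul_right
  have hfgc : Continuous fun x => f x * g x := hf.mul hg
  have hfgI := hfgc.integrable_pow_of_hasCompactSupport hfg' two_ne_zero
  have h1 := sq_integral_mul_le (μ := volume) (f := fun x => f x * g x) (g := h)
    hfgI (hh.integrable_pow_of_hasCompactSupport hh' two_ne_zero)
    ((hfgc.mul hh).integrable_of_hasCompactSupport hfg'.mul_right)
  have e : ∀ x, f x ^ 2 * g x ^ 2 = (f x * g x) ^ 2 := fun x => by ring
  have e4 : ∀ y : ℝ, (y ^ 2) ^ 2 = y ^ 4 := fun y => by ring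
  have h2 := sq_integral_mul_le (μ := volume) (f := fun x => f x ^ 2) (g := fun x => g x ^ 2)
    (by simpa only [e4] using hf.integrable_pow_of_hasCompactSupport hf' four_ne_zero)
    (by simpa only [e4] using hg.integrable_pow_of_hasCompactSupport hg' four_ne_zero)
    (by simpa only [e] using hfgI)
  simp only [e, e4] at h2
  calc (∫ x, f x * g x * h x) ^ 8 = ((∫ x, f x * g x * h x) ^ 2) ^ 4 := by ring
    _ ≤ ((∫ x, (f x * g x) ^ 2) * l2SqS h) ^ 4 := pow_le_pow_left₀ (sq_nonneg _) h1 4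
    _ = ((∫ x, (f x * g x) ^ 2) ^ 2) ^ 2 * l2SqS h ^ 4 := by ring
    _ ≤ ((∫ x, f x ^ 4) * ∫ x, g x ^ 4) ^ 2 * l2SqS h ^ 4 := by
      have : 0 ≤ l2SqS h := integral_nonneg fun _ => sq_nonneg _
      gcongr
    _ = _ := by ring

/-- with `α = n/4`, `n ∈ {2,3}`, there is `c > 0` such that
`|b₂(u,θ,ψ)| ≤ c ‖u‖_{H¹} ‖∇θ‖_{L²}^{1−α} ‖D²θ‖_{L²}^{α} ‖ψ‖_{L²}` for every smooth
compactly supported vector field `u` and smooth compactly supported scalars `θ`, `ψ`. -/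
theorem b2_estimate_H1 {n : ℕ} (hn : n = 2 ∨ n = 3) :
    ∃ c : ℝ, 0 < c ∧
      ∀ (u : (Fin n → ℝ) → (Fin n → ℝ)) (θ ψ : (Fin n → ℝ) → ℝ),
        ContDiff ℝ (⊤ : ℕ∞) u → HasCompactSupport u →
        ContDiff ℝ (⊤ : ℕ∞) θ → HasCompactSupport θ →
        ContDiff ℝ (⊤ : ℕ∞) ψ → HasCompactSupport ψ →
        |b2 u θ ψ| ≤
          c * Real.sqrt (l2SqV u + gradSqV u) *
            Real.sqrt (gradSqS θ) ^ (1 - (n : ℝ) / 4) *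
            Real.sqrt (hessSqS θ) ^ ((n : ℝ) / 4) *
            Real.sqrt (l2SqS ψ) := by
  have hn4 : n ≤ 4 := by omega
  refine ⟨n * 110592, by rcases hn with rfl | rfl <;> norm_num, ?_⟩
  intro u θ ψ hu hu' hθ hθ' hψ hψ'
  have hI : ∀ {v : (Fin n → ℝ) → ℝ}, Continuous v → HasCompactSupport v →
      Integrable fun x => v x ^ 2 := fun hv hv' =>
    hv.integrable_pow_of_hasCompactSupport hv' two_ne_zero
  have hD : ∀ {v : (Fin n → ℝ) → ℝ}, ContDiff ℝ (⊤ : ℕ∞) v → ∀ i : Fin n,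
      ContDiff ℝ (⊤ : ℕ∞) fun x => fderiv ℝ v x (Pi.single i 1) := fun hv i =>
    (hv.fderiv_right (by norm_cast)).clm_apply contDiff_const
  have hD' : ∀ {v : (Fin n → ℝ) → ℝ}, HasCompactSupport v → ∀ i : Fin n,
      HasCompactSupport fun x => fderiv ℝ v x (Pi.single i 1) := fun hv i =>
    hv.fderiv_apply ℝ _
  have huc : ∀ i, ContDiff ℝ (⊤ : ℕ∞) fun x => u x i := contDiff_pi.mp hu
  have huc' : ∀ i, HasCompactSupport fun x => u x i := fun i =>
    hu'.comp_left (g := fun y : Fin n → ℝ => y i) rfl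
  have hdu : ∀ x i j, fderiv ℝ u x (Pi.single i 1) j
      = fderiv ℝ (fun y => u y j) x (Pi.single i 1) := fun x i j => by
    rw [fderiv_pi fun j => (huc j).differentiable (by simp) x]
    rfl
  set U := l2SqV u + gradSqV u
  set G := gradSqS θ
  set H := hessSqS θ
  set P := l2SqS ψ
  have hV0 : 0 ≤ l2SqV u := integral_nonneg fun _ => by positivity
  have hW0 : 0 ≤ gradSqV u := integral_nonneg fun _ => by positivity
  have hU0 : 0 ≤ U := add_nonneg hV0 hW0
  have hG0 : 0 ≤ G := integral_nonneg fun _ => by positivity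
  have hH0 : 0 ≤ H := integral_nonneg fun _ => by positivity
  have hP0 : 0 ≤ P := integral_nonneg fun _ => by positivity
  have hS0 : ∀ v : (Fin n → ℝ) → ℝ, 0 ≤ l2SqS v := fun _ => integral_nonneg fun _ => by positivity
  have hR0 : ∀ v : (Fin n → ℝ) → ℝ, 0 ≤ gradSqS v :=
    fun _ => integral_nonneg fun _ => by positivity
  have hu2 : ∀ i, l2SqS (fun x => u x i) ≤ U := fun i => by
    refine le_trans ?_ (le_add_of_nonneg_right hW0)
    refine integral_mono (hI (huc i).continuous (huc' i))
      (integrable_finsetSum _ fun j _ => hI (huc j).continuous (huc' j)) fun x => ?_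
    exact Finset.single_le_sum (f := fun j => u x j ^ 2) (fun _ _ => sq_nonneg _)
      (Finset.mem_univ i)
  have hdu2 : ∀ i, gradSqS (fun x => u x i) ≤ U := fun i => by
    refine le_trans ?_ (le_add_of_nonneg_left hV0)
    simp only [gradSqV, gradSqS, hdu]
    refine integral_mono
      (integrable_finsetSum _ fun j _ => hI (hD (huc i) j).continuous (hD' (huc' i) j))
      (integrable_finsetSum _ fun j _ => integrable_finsetSum _ fun k _ =>
        hI (hD (huc k) j).continuous (hD' (huc' k) j)) fun x => Finset.sum_le_sum fun j _ => ?_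
    exact Finset.single_le_sum (f := fun k => fderiv ℝ (fun y => u y k) x (Pi.single j 1) ^ 2)
      (fun _ _ => sq_nonneg _) (Finset.mem_univ i)
  have hg2 : ∀ i : Fin n, l2SqS (fun x => fderiv ℝ θ x (Pi.single i 1)) ≤ G := fun i => by
    refine integral_mono (hI (hD hθ i).continuous (hD' hθ' i))
      (integrable_finsetSum _ fun j _ => hI (hD hθ j).continuous (hD' hθ' j)) fun x => ?_
    exact Finset.single_le_sum (f := fun j => fderiv ℝ θ x (Pi.single j 1) ^ 2)
      (fun _ _ => sq_nonneg _) (Finset.mem_univ i)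
  have hdg2 : ∀ i : Fin n, gradSqS (fun x => fderiv ℝ θ x (Pi.single i 1)) ≤ H := fun i => by
    refine integral_mono
      (integrable_finsetSum _ fun j _ =>
        hI (hD (hD hθ i) j).continuous (hD' (hD' hθ' i) j))
      (integrable_finsetSum _ fun k _ => integrable_finsetSum _ fun j _ =>
        hI (hD (hD hθ k) j).continuous (hD' (hD' hθ' k) j)) fun x => ?_
    exact Finset.single_le_sum (f := fun k : Fin n => ∑ j : Fin n,
      (fderiv ℝ (fun y => fderiv ℝ θ y (Pi.single k 1)) x (Pi.single j 1)) ^ 2)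
      (fun _ _ => by positivity) (Finset.mem_univ i)
  have hrpow : ∀ {a : ℝ} (r : ℝ) (k : ℕ), 0 ≤ a → r * 4 = k → (√a ^ r) ^ 8 = a ^ k := by
    intro a r k ha hr
    rw [← Real.rpow_natCast (_ ^ r), ← Real.rpow_mul (Real.sqrt_nonneg _),
      show r * (8 : ℕ) = ((2 * k : ℕ) : ℝ) by push_cast; linarith, Real.rpow_natCast, pow_mul,
      Real.sq_sqrt ha]
  have hsqrt : ∀ {a : ℝ}, 0 ≤ a → √a ^ 8 = a ^ 4 := fun {a} ha => by
    rw [show √a ^ 8 = (√a ^ 2) ^ 4 by ring, Real.sq_sqrt ha]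
  have hterm : ∀ i : Fin n, |∫ x, u x i * fderiv ℝ θ x (Pi.single i 1) * ψ x|
      ≤ 110592 * √U * √G ^ (1 - (n : ℝ) / 4) * √H ^ ((n : ℝ) / 4) * √P := by
    intro i
    refine le_of_pow_le_pow_left₀ (n := 8) (by norm_num) (by positivity) ?_
    rw [Even.pow_abs (by decide)]
    have hLu := sq_integral_pow_four_le hn ((huc i).of_le (by simp)) (huc' i)
    have hLg := sq_integral_pow_four_le hn ((hD hθ i).of_le (by simp)) (hD' hθ' i)
    have hLu' : (∫ x, u x i ^ 4) ^ 2 ≤ 110592 * U ^ 4 := by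
      calc _ ≤ _ := hLu
        _ ≤ 110592 * U ^ (4 - n) * U ^ n := by
          gcongr
          exacts [pow_nonneg (hR0 _) _, hS0 _, hu2 i, hR0 _, hdu2 i]
        _ = 110592 * U ^ 4 := by rw [mul_assoc, ← pow_add, Nat.sub_add_cancel hn4]
    have hLg' : (∫ x, fderiv ℝ θ x (Pi.single i 1) ^ 4) ^ 2
        ≤ 110592 * G ^ (4 - n) * H ^ n := by
      refine hLg.trans ?_
      gcongr
      exacts [pow_nonneg (hR0 _) _, hS0 _, hg2 i, hR0 _, hdg2 i]
    calc _ ≤ _ := integral_mul_mul_pow_eight_le (huc i).continuous (huc' i)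
            (hD hθ i).continuous (hD' hθ' i) hψ.continuous hψ'
      _ ≤ 110592 * U ^ 4 * (110592 * G ^ (4 - n) * H ^ n) * P ^ 4 := by gcongr
      _ = 110592 ^ 2 * (U ^ 4 * G ^ (4 - n) * H ^ n * P ^ 4) := by ring
      _ ≤ 110592 ^ 8 * (U ^ 4 * G ^ (4 - n) * H ^ n * P ^ 4) := by gcongr <;> norm_num
      _ = _ := by
        rw [mul_pow, mul_pow, mul_pow, mul_pow, hsqrt hU0, hsqrt hP0,
          hrpow _ (4 - n) hG0 (by push_cast [Nat.cast_sub hn4]; ring), hrpow _ n hH0 (by ring)]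
        ring
  calc |b2 u θ ψ| ≤ ∑ i : Fin n, |∫ x, u x i * fderiv ℝ θ x (Pi.single i 1) * ψ x| :=
        Finset.abs_sum_le_sum_abs _ _
    _ ≤ ∑ _i : Fin n, 110592 * √U * √G ^ (1 - (n : ℝ) / 4) * √H ^ ((n : ℝ) / 4) * √P :=
        Finset.sum_le_sum fun i _ => hterm i
    _ = _ := by
        rw [Finset.sum_const, Finset.card_univ, Fintype.card_fin, nsmul_eq_mul]
        ring
end
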